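/- Let 𝒫 be an imprecise probability tree and Q̄ an upper expectation tree that agree, let s be a situation, and let f: Ω → ℝ̄ be either (a) the pointwise limit of a monotone (nondecreasing or non-increasing) sequence of finitary gambles, or (b) an ℱ-measurable gamble. Then both Ē_𝒫(f|s) = Ē_Q̄(f|s) and, for the conjugate lower expectations defined by Ē̲(f|s) := −Ē(−f|s), also E̲_𝒫(f|s) = E̲_Q̄(f|s). -/

import Mathlib

open Filter MeasureTheory Topology
open scoped ENNReal

namespace UEPaper

variable {X : Type} [Fintype X] [Nonempty X] [DecidableEq X]

/-- The set of paths: infinite sequences of states (`ω i` is the `(i+1)`-th state). -/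
abbrev Path (X : Type) := ℕ → X

/-- The prefix `ω^k` of length `k` of a path, as a list (a situation). -/
def prefixList (ω : Path X) (k : ℕ) : List X := (List.range k).map ω

/-- The cylinder event `Γ(s)` of a situation `s`. -/
def cyl (s : List X) : Set (Path X) := {ω | prefixList ω s.length = s}

/-- `f` is `n`-measurable: it depends only on the first `n` states. -/
def NMeas (n : ℕ) (f : Path X → EReal) : Prop :=
  ∀ ω ω' : Path X, prefixList ω n = prefixList ω' n → f ω = f ω'

/-- A gamble: a bounded real-valued global variable. -/
def IsGamble (f : Path X → EReal) : Prop :=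
  ∃ B : ℝ, ∀ ω, -(B : EReal) ≤ f ω ∧ f ω ≤ (B : EReal)

/-- A finitary gamble: an `n`-measurable gamble for some `n`. -/
def IsFinGamble (f : Path X → EReal) : Prop :=
  (∃ n, NMeas n f) ∧ IsGamble f

/-- An upper expectation tree: a coherent upper expectation at each situation. -/
structure UpperExpTree (X : Type) [Fintype X] [Nonempty X] where
  Q : List X → (X → ℝ) → ℝ
  le_sup : ∀ (s : List X) (f : X → ℝ), Q s f ≤ ⨆ x, f x
  subadd : ∀ (s : List X) (f g : X → ℝ), Q s (f + g) ≤ Q s f + Q s g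
  pos_homog : ∀ (s : List X) (l : ℝ) (f : X → ℝ), 0 ≤ l → Q s (l • f) = l * Q s f

/-- A (real-valued) supermartingale for the upper expectation tree `Q`. -/
def IsSupermart (Q : UpperExpTree X) (M : List X → ℝ) : Prop :=
  ∀ s : List X, Q.Q s (fun x => M (s ++ [x])) ≤ M s

/-- The game-theoretic upper expectation of a real-valued variable (used on gambles):
the infimum of `M s` over bounded-below supermartingales `M` with
`liminf_k M(ω^k) ≥ f(ω)` on `Γ(s)`. -/
noncomputable def gtG (Q : UpperExpTree X) (f : Path X → ℝ) (s : List X) : EReal :=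
  sInf {a : EReal | ∃ M : List X → ℝ, IsSupermart Q M ∧ (∃ B : ℝ, ∀ t, B ≤ M t) ∧
    (∀ ω ∈ cyl s,
      (f ω : EReal) ≤ Filter.liminf (fun k => ((M (prefixList ω k) : ℝ) : EReal)) atTop) ∧
    a = ((M s : ℝ) : EReal)}

/-- Extension to bounded-below variables, by continuity w.r.t. upper cuts:
`Ē(f|s) = lim_{c → +∞} Ē(min(f,c)|s)` (the limit of this nondecreasing net is a supremum). -/
noncomputable def gtBB (Q : UpperExpTree X) (f : Path X → EReal) (s : List X) : EReal :=
  ⨆ c : ℝ, gtG Q (fun ω => (f ω ⊓ (c : EReal)).toReal) s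

/-- The game-theoretic global upper expectation `Ē_Q̄`, extended to all extended
real variables by continuity w.r.t. lower cuts:
`Ē(f|s) = lim_{c → −∞} Ē(max(f,c)|s)` (the limit of this nonincreasing net is an infimum). -/
noncomputable def gtUE (Q : UpperExpTree X) (f : Path X → EReal) (s : List X) : EReal :=
  ⨅ c : ℝ, gtBB Q (fun ω => f ω ⊔ (c : EReal)) s

/-- A precise probability tree: a probability mass function at each situation. -/
structure PreciseTree (X : Type) [Fintype X] where
  p : List X → X → ℝ
  nonneg : ∀ (s : List X) (x : X), 0 ≤ p s x
  sum_one : ∀ s : List X, ∑ x, p s x = 1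

/-- An imprecise probability tree: a nonempty closed convex set of probability mass
functions at each situation. -/
structure ImpreciseTree (X : Type) [Fintype X] where
  sets : List X → Set (X → ℝ)
  nonempty' : ∀ s : List X, (sets s).Nonempty
  closed' : ∀ s : List X, IsClosed (sets s)
  convex' : ∀ s : List X, Convex ℝ (sets s)
  prob' : ∀ s : List X, ∀ q ∈ sets s, (∀ x, 0 ≤ q x) ∧ ∑ x, q x = 1

/-- `p ∼ 𝒫`: the precise tree `p` is compatible with the imprecise tree `P`. -/
def Compatible (p : PreciseTree X) (P : ImpreciseTree X) : Prop :=
  ∀ s : List X, p.p s ∈ P.sets s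

/-- The probability `P_p(Γ(z)|s)` of the cylinder of `z` conditional on situation `s`. -/
noncomputable def cylProb (p : List X → X → ℝ) (s z : List X) : ℝ :=
  if s.length < z.length ∧ z.take s.length = s then
    ∏ i ∈ Finset.Ico s.length z.length, p (z.take i) (z.getD i (Classical.arbitrary X))
  else if z.length ≤ s.length ∧ s.take z.length = z then 1 else 0

/-- The σ-algebra `ℱ` on paths generated by the cylinder events. -/
instance cylSigma : MeasurableSpace (Path X) :=
  MeasurableSpace.generateFrom {A | ∃ s : List X, A = cyl s}

/-- `μ` is the probability measure `P_p(·|s)` on `ℱ` determined by the tree `p`. -/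
def IsTreeMeasure (p : PreciseTree X) (s : List X) (μ : Measure (Path X)) : Prop :=
  IsProbabilityMeasure μ ∧ ∀ z : List X, μ (cyl z) = ENNReal.ofReal (cylProb p.p s z)

/-- Positive part of an extended real, in `ℝ≥0∞`. -/
noncomputable def posPart (x : EReal) : ℝ≥0∞ := if x = ⊤ then ⊤ else ENNReal.ofReal x.toReal

/-- The Lebesgue integral `∫ g dμ = ∫ g⁺ dμ − ∫ g⁻ dμ` of an extended-real variable
(well-defined, with value in `(-∞, +∞]`, for bounded-below measurable `g`). -/
noncomputable def integralE (μ : Measure (Path X)) (g : Path X → EReal) : EReal :=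
  ((∫⁻ ω, posPart (g ω) ∂μ : ℝ≥0∞) : EReal) - ((∫⁻ ω, posPart (-(g ω)) ∂μ : ℝ≥0∞) : EReal)

/-- The upper integral `Ē_p(f|s)`: infimum of integrals of bounded-below
`ℱ`-measurable variables dominating `f`. -/
noncomputable def upperInt (μ : Measure (Path X)) (f : Path X → EReal) : EReal :=
  sInf {a : EReal | ∃ g : Path X → EReal, Measurable g ∧ (∃ B : ℝ, ∀ ω, (B : EReal) ≤ g ω) ∧
    (∀ ω, f ω ≤ g ω) ∧ a = integralE μ g}

/-- The measure-theoretic global upper expectation `Ē_𝒫(f|s)`, given the assignment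
`Pm` of the measures `P_p(·|s)` to precise trees: the upper envelope of the upper
integrals over all compatible precise trees. -/
noncomputable def muUE (Pm : PreciseTree X → List X → Measure (Path X))
    (P : ImpreciseTree X) (f : Path X → EReal) (s : List X) : EReal :=
  ⨆ (p : PreciseTree X) (_ : Compatible p P), upperInt (Pm p s) f

/-- The trees `P` and `Q` agree: each `Q̄_s` is the upper envelope of the expectations
corresponding to the credal set `𝒫_s`. -/
def Agree (P : ImpreciseTree X) (Q : UpperExpTree X) : Prop :=
  ∀ (s : List X) (f : X → ℝ),
    Q.Q s f = sSup {r : ℝ | ∃ q ∈ P.sets s, r = ∑ x, f x * q x}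

/-- Axioms P1–P5 for a global upper expectation `E` w.r.t. the tree `Q`. -/
structure Axioms (Q : UpperExpTree X) (E : (Path X → EReal) → List X → EReal) : Prop where
  p1 : ∀ (f : X → ℝ) (s : List X),
    E (fun ω => ((f (ω s.length) : ℝ) : EReal)) s = ((Q.Q s f : ℝ) : EReal)
  p2 : ∀ f : Path X → EReal, IsFinGamble f → ∀ s : List X, E f s = E ((cyl s).indicator f) s
  p3 : ∀ f : Path X → EReal, IsFinGamble f → ∀ s : List X,
    E f s ≤ E (fun ω => E f (prefixList ω (s.length + 1))) s
  p4 : ∀ f g : Path X → EReal, (∀ ω, f ω ≤ g ω) → ∀ s : List X, E f s ≤ E g s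
  p5 : ∀ (s : List X) (fn : ℕ → Path X → EReal) (f : Path X → EReal),
    (∀ n, IsFinGamble (fn n)) → (∃ B : ℝ, ∀ n ω, (B : EReal) ≤ fn n ω) →
    (∀ ω, Tendsto (fun n => fn n ω) atTop (nhds (f ω))) →
    E f s ≤ limsup (fun n => E (fn n) s) atTop

/-- Upper semicontinuity of an extended-real variable on the path space. -/
def USC [TopologicalSpace X] [DiscreteTopology X] (f : Path X → EReal) : Prop :=
  ∀ a : ℝ, IsOpen {ω : Path X | f ω < (a : EReal)}

/-- An `Ω`-capacity (Dellacherie): a monotone `[0,∞]`-valued functional on nonnegative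
variables, continuous along nondecreasing sequences, and continuous along
nonincreasing sequences of nonnegative real-valued upper semicontinuous functions. -/
def IsCapacity [TopologicalSpace X] [DiscreteTopology X]
    (F : (Path X → EReal) → EReal) : Prop :=
  (∀ f : Path X → EReal, (∀ ω, 0 ≤ f ω) → 0 ≤ F f) ∧
  (∀ f g : Path X → EReal, (∀ ω, 0 ≤ f ω) → (∀ ω, 0 ≤ g ω) → (∀ ω, f ω ≤ g ω) → F f ≤ F g) ∧
  (∀ fn : ℕ → Path X → EReal, (∀ n ω, 0 ≤ fn n ω) → Monotone fn →
    Tendsto (fun n => F (fn n)) atTop (nhds (F (fun ω => ⨆ n, fn n ω)))) ∧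
  (∀ fn : ℕ → Path X → EReal, (∀ n ω, 0 ≤ fn n ω ∧ fn n ω < ⊤) → (∀ n, USC (fn n)) →
    Antitone fn →
    Tendsto (fun n => F (fn n)) atTop (nhds (F (fun ω => ⨅ n, fn n ω))))

open Classical in
/-- The metric `δ(ω,ω') = 2^{-n}`, `n` the first (1-based) index where `ω` and `ω'` differ. -/
noncomputable def delta (ω ω' : Path X) : ℝ :=
  if h : ω = ω' then 0
  else (1 / 2 : ℝ) ^ (Nat.find (Function.ne_iff.mp h) + 1)

/-- The product topology on the path space (with `X` discrete). -/
def prodTop (X : Type) : TopologicalSpace (ℕ → X) :=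
  @Pi.topologicalSpace ℕ (fun _ => X) (fun _ => ⊥)

/-! ### Prefixes and cylinders -/

lemma length_prefixList {X : Type} (ω : Path X) (k : ℕ) : (prefixList ω k).length = k := by
  simp [prefixList]

lemma prefixList_succ {X : Type} (ω : Path X) (k : ℕ) :
    prefixList ω (k + 1) = prefixList ω k ++ [ω k] := by
  simp [prefixList, List.range_succ]

lemma take_prefixList {X : Type} (ω : Path X) {k n : ℕ} (h : k ≤ n) :
    (prefixList ω n).take k = prefixList ω k := by
  simp [prefixList, ← List.map_take, List.take_range, h]

lemma prefixList_eq_iff {X : Type} {ω ω' : Path X} {n : ℕ} :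
    prefixList ω n = prefixList ω' n ↔ ∀ i < n, ω i = ω' i := by
  simp [prefixList]

lemma mem_cyl_prefixList {X : Type} (ω : Path X) (k : ℕ) : ω ∈ cyl (prefixList ω k) := by
  simp [cyl, length_prefixList]

lemma prefix_prefixList {X : Type} {ω : Path X} {s : List X} (h : ω ∈ cyl s) {k : ℕ}
    (hk : s.length ≤ k) : s <+: prefixList ω k := by
  rw [List.prefix_iff_eq_take, take_prefixList ω hk]
  exact (show prefixList ω s.length = s from h).symm

/-- Some path through a given situation. -/
noncomputable def extendPath {X : Type} [Nonempty X] (z : List X) : Path X :=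
  fun i => z.getD i (Classical.arbitrary X)

lemma prefixList_extendPath {X : Type} [Nonempty X] (z : List X) :
    prefixList (extendPath z) z.length = z := by
  apply List.ext_getElem
  · simp [prefixList]
  · intro i h1 h2
    simp [prefixList, extendPath, h2]

/-- A path through `t` that picks its later states by a rule. -/
lemma exists_path_rule {X : Type} (t : List X) (r : List X → X) :
    ∃ ω : Path X, prefixList ω t.length = t ∧
      ∀ k, t.length ≤ k → ω k = r (prefixList ω k) := by
  let u : ℕ → List X := fun n => Nat.rec t (fun _ v => v ++ [r v]) n
  let ω : Path X := fun i => if h : i < t.length then t[i] else r (u (i - t.length))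
  have h0 : prefixList ω t.length = t := by
    apply List.ext_getElem
    · simp [prefixList]
    · intro i h1 h2
      simp [prefixList, ω, h2]
  have hu : ∀ n, prefixList ω (t.length + n) = u n := by
    intro n
    induction n with
    | zero => exact h0
    | succ n ih =>
      rw [← add_assoc, prefixList_succ, ih]
      simp [ω, u]
  refine ⟨ω, h0, fun k hk => ?_⟩
  obtain ⟨n, rfl⟩ := Nat.exists_eq_add_of_le hk
  rw [hu]
  simp [ω]

/-! ### Coherent upper expectations -/

namespace UpperExpTree

variable {X : Type} [Fintype X] [Nonempty X] (Q : UpperExpTree X)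

lemma le_of_forall_le (s : List X) {f : X → ℝ} {c : ℝ} (h : ∀ x, f x ≤ c) : Q.Q s f ≤ c :=
  (Q.le_sup s f).trans (ciSup_le h)

lemma le_add_of_le (s : List X) {f g : X → ℝ} {c : ℝ} (h : ∀ x, f x ≤ g x + c) :
    Q.Q s f ≤ Q.Q s g + c := by
  have h1 := Q.subadd s g (f - g)
  rw [add_sub_cancel] at h1
  have h2 : Q.Q s (f - g) ≤ c := Q.le_of_forall_le s fun x => by
    have := h x
    simp only [Pi.sub_apply]
    linarith
  linarith

lemma mono (s : List X) {f g : X → ℝ} (h : ∀ x, f x ≤ g x) : Q.Q s f ≤ Q.Q s g := by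
  simpa using Q.le_add_of_le s (c := 0) (by simpa using h)

lemma ge_of_forall_ge (s : List X) {f : X → ℝ} {c : ℝ} (h : ∀ x, c ≤ f x) : c ≤ Q.Q s f := by
  have h0 : Q.Q s 0 = 0 := by simpa using Q.pos_homog s 0 0 le_rfl
  have := Q.le_add_of_le s (f := 0) (g := f) (c := -c) fun x => by
    have := h x
    simp only [Pi.zero_apply]
    linarith
  linarith

end UpperExpTree

/-! ### Supermartingales -/

section Supermartingale

variable {X : Type} [Fintype X] [Nonempty X] {Q : UpperExpTree X}

lemma IsSupermart.add {M N : List X → ℝ} (hM : IsSupermart Q M) (hN : IsSupermart Q N) :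
    IsSupermart Q (fun t => M t + N t) := fun s =>
  (Q.subadd s (fun x => M (s ++ [x])) (fun x => N (s ++ [x]))).trans (add_le_add (hM s) (hN s))

lemma IsSupermart.const_mul {M : List X → ℝ} (hM : IsSupermart Q M) {c : ℝ} (hc : 0 ≤ c) :
    IsSupermart Q (fun t => c * M t) := fun s =>
  (Q.pos_homog s c (fun x => M (s ++ [x])) hc).trans_le
    (mul_le_mul_of_nonneg_left (hM s) hc)

lemma isSupermart_const (c : ℝ) : IsSupermart Q (fun _ => c) := fun s =>
  Q.le_of_forall_le s fun _ => le_rfl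

lemma IsSupermart.min_const {M : List X → ℝ} (hM : IsSupermart Q M) (c : ℝ) :
    IsSupermart Q (fun t => min (M t) c) := fun s =>
  le_min ((Q.mono s fun _ => min_le_left _ _).trans (hM s))
    (Q.le_of_forall_le s fun _ => min_le_right _ _)

lemma IsSupermart.sum {ι : Type*} (S : Finset ι) {M : ι → List X → ℝ}
    (hM : ∀ i, IsSupermart Q (M i)) : IsSupermart Q (fun t => ∑ i ∈ S, M i t) := by
  classical
  induction S using Finset.induction_on with
  | empty => simpa using isSupermart_const (Q := Q) 0
  | insert i S hi ih => simpa [Finset.sum_insert hi] using (hM i).add ih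

lemma IsSupermart.exists_le {M : List X → ℝ} (hM : IsSupermart Q M) (t : List X) :
    ∃ x, M (t ++ [x]) ≤ M t := by
  obtain ⟨x, hx⟩ := Finite.exists_min fun x => M (t ++ [x])
  exact ⟨x, (Q.ge_of_forall_ge t hx).trans (hM t)⟩

/-- A pointwise limit of supermartingales is a supermartingale. -/
lemma IsSupermart.of_tendsto {M : ℕ → List X → ℝ} {L : List X → ℝ}
    (hM : ∀ n, IsSupermart Q (M n)) (hL : ∀ t, Tendsto (fun n => M n t) atTop (𝓝 (L t))) :
    IsSupermart Q L := by
  intro s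
  refine le_of_forall_pos_le_add fun ε hε => ?_
  have h1 : ∀ᶠ n in atTop, ∀ x, L (s ++ [x]) ≤ M n (s ++ [x]) + ε / 2 := by
    rw [eventually_all]
    intro x
    filter_upwards [(hL (s ++ [x])).eventually_const_lt (sub_lt_self _ (half_pos hε))] with n hn
    linarith
  obtain ⟨n, hn1, hn2⟩ :=
    (h1.and ((hL s).eventually_lt_const (lt_add_of_pos_right _ (half_pos hε)))).exists
  have := Q.le_add_of_le s hn1
  have := hM n s
  linarith

/-- `M` is a bounded-below supermartingale whose lower limit dominates `f` on `Γ(s)`. -/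
def Superhedges (Q : UpperExpTree X) (f : Path X → ℝ) (s : List X) (M : List X → ℝ) : Prop :=
  IsSupermart Q M ∧ (∃ B : ℝ, ∀ t, B ≤ M t) ∧
    ∀ ω ∈ cyl s, ∀ r < f ω, ∀ᶠ k in atTop, r < M (prefixList ω k)

/-- The game-theoretic upper expectation of a gamble as a real infimum. -/
noncomputable def gameUpper (Q : UpperExpTree X) (f : Path X → ℝ) (s : List X) : ℝ :=
  sInf {a : ℝ | ∃ M, Superhedges Q f s M ∧ a = M s}

lemma coe_le_liminf_iff {a : ℝ} {u : ℕ → ℝ} :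
    (a : EReal) ≤ liminf (fun k => (u k : EReal)) atTop ↔
      ∀ r < a, ∀ᶠ k in atTop, r < u k := by
  rw [le_liminf_iff]
  constructor
  · intro h r hr
    simpa using h r (by exact_mod_cast hr)
  · intro h y hy
    obtain ⟨r, hyr, hra⟩ := EReal.lt_iff_exists_real_btwn.1 hy
    filter_upwards [h r (by exact_mod_cast hra)] with k hk
    exact hyr.trans (by exact_mod_cast hk)

variable {f g : Path X → ℝ} {s t : List X} {M : List X → ℝ} {b c : ℝ}

lemma Superhedges.le_apply (hM : Superhedges Q f s M) (hf : ∀ ω, b ≤ f ω) (hst : s <+: t) :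
    b ≤ M t := by
  by_contra! hlt
  choose r hr using hM.1.exists_le
  obtain ⟨ω, h0, h1⟩ := exists_path_rule t r
  have hω : ω ∈ cyl s := by
    have := List.prefix_iff_eq_take.1 hst
    rw [← h0, take_prefixList ω hst.length_le] at this
    exact this.symm
  have hle : ∀ k, t.length ≤ k → M (prefixList ω k) ≤ M t := by
    intro k hk
    induction k, hk using Nat.le_induction with
    | base => rw [h0]
    | succ k hk ih =>
      rw [prefixList_succ, h1 k hk]
      exact (hr _).trans ih
  obtain ⟨k, hk1, hk2⟩ :=
    ((hM.2.2 ω hω (M t) (hlt.trans_le (hf ω))).and (eventually_ge_atTop t.length)).exists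
  exact (hk1.trans_le (hle k hk2)).false

/-- A superhedging supermartingale can be taken within the bounds of the gamble. -/
lemma Superhedges.exists_bounded (hM : Superhedges Q f s M) (hf : ∀ ω, b ≤ f ω ∧ f ω ≤ c) :
    ∃ N, Superhedges Q f s N ∧ (∀ t, b ≤ N t ∧ N t ≤ c) ∧ N s ≤ M s := by
  classical
  have hbc : b ≤ c := (hf (extendPath s)).1.trans (hf _).2
  let N : List X → ℝ := fun t => if s <+: t then min (M t) c else c
  have hNle : ∀ t, N t ≤ c := fun t => by
    by_cases h : s <+: t <;> simp [N, h]
  have hble : ∀ t, b ≤ N t := fun t => by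
    by_cases h : s <+: t
    · simp [N, h, hbc, hM.le_apply (fun ω => (hf ω).1) h]
    · simp [N, h, hbc]
  refine ⟨N, ⟨fun t => ?_, ⟨b, hble⟩, fun ω hω r hr => ?_⟩, fun t => ⟨hble t, hNle t⟩, ?_⟩
  · by_cases h : s <+: t
    · have h' : ∀ x, s <+: t ++ [x] := fun x => h.trans (List.prefix_append _ _)
      simpa [N, h, h'] using hM.1.min_const c t
    · have : N t = c := by simp [N, h]
      rw [this]
      exact Q.le_of_forall_le t fun x => hNle _
  · filter_upwards [hM.2.2 ω hω r hr, eventually_ge_atTop s.length] with k hk hk2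
    simp [N, prefix_prefixList hω hk2, hk, hr.trans_le (hf ω).2]
  · simp [N]

lemma superhedges_const (h : ∀ ω, f ω ≤ c) : Superhedges Q f s fun _ => c :=
  ⟨isSupermart_const c, ⟨c, fun _ => le_rfl⟩, fun ω _ _ hr =>
    Eventually.of_forall fun _ => hr.trans_le (h ω)⟩

lemma Superhedges.mono (hM : Superhedges Q g s M) (h : ∀ ω, f ω ≤ g ω) : Superhedges Q f s M :=
  ⟨hM.1, hM.2.1, fun ω hω r hr => hM.2.2 ω hω r (hr.trans_le (h ω))⟩

lemma gameUpper_le (hf : ∀ ω, b ≤ f ω) (hM : Superhedges Q f s M) : gameUpper Q f s ≤ M s :=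
  csInf_le ⟨b, by rintro _ ⟨N, hN, rfl⟩; exact hN.le_apply hf List.prefix_rfl⟩ ⟨M, hM, rfl⟩

lemma le_gameUpper (hf : ∀ ω, f ω ≤ c) {a : ℝ} (h : ∀ M, Superhedges Q f s M → a ≤ M s) :
    a ≤ gameUpper Q f s :=
  le_csInf ⟨_, _, superhedges_const hf, rfl⟩ (by rintro _ ⟨N, hN, rfl⟩; exact h N hN)

lemma gameUpper_mem_bounds (hf : ∀ ω, b ≤ f ω ∧ f ω ≤ c) (s : List X) :
    b ≤ gameUpper Q f s ∧ gameUpper Q f s ≤ c :=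
  ⟨le_gameUpper (fun ω => (hf ω).2) fun _ hM => hM.le_apply (fun ω => (hf ω).1) List.prefix_rfl,
    gameUpper_le (fun ω => (hf ω).1) (superhedges_const fun ω => (hf ω).2)⟩

lemma exists_superhedges_lt (hf : ∀ ω, b ≤ f ω ∧ f ω ≤ c) {r : ℝ} (h : gameUpper Q f s < r) :
    ∃ M, Superhedges Q f s M ∧ (∀ t, b ≤ M t ∧ M t ≤ c) ∧ M s < r := by
  obtain ⟨_, ⟨M, hM, rfl⟩, hlt⟩ : ∃ a ∈ {a | ∃ M, Superhedges Q f s M ∧ a = M s}, a < r :=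
    exists_lt_of_csInf_lt ⟨_, _, superhedges_const fun ω => (hf ω).2, rfl⟩ h
  obtain ⟨N, hN, hb, hNM⟩ := hM.exists_bounded hf
  exact ⟨N, hN, hb, hNM.trans_lt hlt⟩

lemma gameUpper_mono (hf : ∀ ω, b ≤ f ω) (hg : ∀ ω, g ω ≤ c) (h : ∀ ω, f ω ≤ g ω) (s : List X) :
    gameUpper Q f s ≤ gameUpper Q g s :=
  le_gameUpper hg fun _ hM => gameUpper_le hf (hM.mono h)

lemma isSupermart_gameUpper (hf : ∀ ω, b ≤ f ω ∧ f ω ≤ c) : IsSupermart Q (gameUpper Q f) := by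
  intro t
  refine le_gameUpper (fun ω => (hf ω).2) fun M hM => (Q.mono t fun x => ?_).trans (hM.1 t)
  refine gameUpper_le (fun ω => (hf ω).1) ⟨hM.1, hM.2.1, fun ω hω => hM.2.2 ω ?_⟩
  have h : prefixList ω (t ++ [x]).length = t ++ [x] := hω
  rw [List.length_append, List.length_singleton, prefixList_succ] at h
  exact (List.append_inj' h rfl).1

lemma gtG_eq_coe_gameUpper (hf : ∀ ω, b ≤ f ω ∧ f ω ≤ c) (s : List X) :
    gtG Q f s = (gameUpper Q f s : EReal) := by
  apply le_antisymm
  · refine le_of_forall_gt fun y hy => ?_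
    obtain ⟨r, hr1, hr2⟩ := EReal.lt_iff_exists_real_btwn.1 hy
    obtain ⟨M, hM, -, hlt⟩ := exists_superhedges_lt hf (by exact_mod_cast hr1)
    refine lt_of_le_of_lt (sInf_le ⟨M, hM.1, hM.2.1, fun ω hω => ?_, rfl⟩)
      (lt_trans (by exact_mod_cast hlt) hr2)
    exact coe_le_liminf_iff.2 (hM.2.2 ω hω)
  · refine le_sInf ?_
    rintro _ ⟨M, h1, h2, h3, rfl⟩
    exact_mod_cast gameUpper_le (fun ω => (hf ω).1)
      ⟨h1, h2, fun ω hω => coe_le_liminf_iff.1 (h3 ω hω)⟩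

lemma gameUpper_add_const_ge (hf : ∀ ω, b ≤ f ω ∧ f ω ≤ c) (a : ℝ) (s : List X) :
    gameUpper Q f s + a ≤ gameUpper Q (fun ω => f ω + a) s := by
  refine le_gameUpper (c := c + a) (fun ω => by linarith [(hf ω).2]) fun M hM => ?_
  have : gameUpper Q f s ≤ M s + -a := by
    obtain ⟨B, hB⟩ := hM.2.1
    refine gameUpper_le (fun ω => (hf ω).1) (M := fun t => M t + -a)
      ⟨hM.1.add (isSupermart_const _), ⟨B + -a, fun t => by linarith [hB t]⟩,
        fun ω hω r hr => ?_⟩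
    filter_upwards [hM.2.2 ω hω (r + a) (by linarith)] with k hk
    linarith
  linarith

/-- Switching from `M` to near-optimal supermartingales on reaching a situation of `S`. -/
lemma gameUpper_le_of_stopping (hf : ∀ ω, b ≤ f ω ∧ f ω ≤ c) (hM : IsSupermart Q M)
    (hMb : ∃ B, ∀ t, B ≤ M t) (S : Set (List X)) (hS : ∀ u ∈ S, gameUpper Q f u ≤ M u)
    (hns : ∀ ω ∈ cyl t, (∀ k ≥ t.length, prefixList ω k ∉ S) →
      ∀ r < f ω, ∀ᶠ k in atTop, r < M (prefixList ω k)) :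
    gameUpper Q f t ≤ M t := by
  classical
  refine le_of_forall_pos_le_add fun ε hε => ?_
  have hT : ∀ u, ∃ T, Superhedges Q f u T ∧ (∀ t, b ≤ T t ∧ T t ≤ c) ∧
      T u < gameUpper Q f u + ε := fun u => exists_superhedges_lt hf (lt_add_of_pos_right _ hε)
  choose T hTs hTb hTu using hT
  let H : List X → ℕ → Prop := fun v k => t.length ≤ k ∧ k ≤ v.length ∧ v.take k ∈ S
  let N : List X → ℝ := fun v => if h : ∃ k, H v k then T (v.take (Nat.find h)) v else M v + ε
  have hN1 : ∀ v (h : ∃ k, H v k), N v = T (v.take (Nat.find h)) v := fun v h => dif_pos h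
  have hN2 : ∀ v, (¬ ∃ k, H v k) → N v = M v + ε := fun v h => dif_neg h
  have hle : ∀ v, (∀ k < v.length, ¬ H v k) → N v ≤ M v + ε := by
    intro v hv
    by_cases h : ∃ k, H v k
    · have hk : Nat.find h = v.length :=
        le_antisymm (Nat.find_spec h).2.1 (not_lt.1 fun hlt => hv _ hlt (Nat.find_spec h))
      have hmem := (Nat.find_spec h).2.2
      rw [hN1 v h]
      rw [hk, List.take_length] at *
      linarith [hTu v, hS v hmem]
    · rw [hN2 v h]
  have hsuper : IsSupermart Q N := by
    intro v
    by_cases h : ∃ k, H v k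
    · have hx : ∀ x, N (v ++ [x]) = T (v.take (Nat.find h)) (v ++ [x]) := by
        intro x
        have hiff : ∀ k ≤ v.length, H (v ++ [x]) k ↔ H v k := by
          intro k hk
          simp only [H, List.take_append_of_le_length hk, List.length_append,
            List.length_singleton]
          constructor <;> rintro ⟨h1, h2, h3⟩ <;> exact ⟨h1, by omega, h3⟩
        have hle := (Nat.find_spec h).2.1
        have h' : ∃ k, H (v ++ [x]) k := ⟨_, (hiff _ hle).2 (Nat.find_spec h)⟩
        have hfind : Nat.find h' = Nat.find h := by
          rw [Nat.find_eq_iff]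
          exact ⟨(hiff _ hle).2 (Nat.find_spec h), fun n hn hHn =>
            Nat.find_min h hn ((hiff n (hn.le.trans hle)).1 hHn)⟩
        rw [hN1 _ h', hfind, List.take_append_of_le_length hle]
      rw [hN1 v h]
      simp only [hx]
      exact (hTs _).1 v
    · rw [hN2 v h]
      refine (Q.le_add_of_le v (g := fun x => M (v ++ [x])) (c := ε) fun x => hle _ ?_).trans
        (add_le_add_left (hM v) ε)
      intro k hk hH
      have hk' : k ≤ v.length := by simpa [Nat.lt_succ_iff] using hk
      refine h ⟨k, hH.1, hk', ?_⟩
      simpa [List.take_append_of_le_length hk'] using hH.2.2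
  have hbdd : ∃ B, ∀ v, B ≤ N v := by
    obtain ⟨B, hB⟩ := hMb
    refine ⟨min b B, fun v => ?_⟩
    by_cases h : ∃ k, H v k
    · rw [hN1 v h]
      exact (min_le_left _ _).trans (hTb _ _).1
    · rw [hN2 v h]
      linarith [min_le_right b B, hB v]
  have hhedge : Superhedges Q f t N := by
    refine ⟨hsuper, hbdd, fun ω hω r hr => ?_⟩
    by_cases h : ∃ k, t.length ≤ k ∧ prefixList ω k ∈ S
    · have hspec := Nat.find_spec h
      filter_upwards [(hTs (prefixList ω (Nat.find h))).2.2 ω (mem_cyl_prefixList _ _) r hr,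
        eventually_ge_atTop (Nat.find h)] with j hj hjk
      have h' : ∃ k, H (prefixList ω j) k :=
        ⟨Nat.find h, hspec.1, by rwa [length_prefixList], by rw [take_prefixList ω hjk]; exact hspec.2⟩
      have hfind : Nat.find h' = Nat.find h := by
        rw [Nat.find_eq_iff]
        refine ⟨⟨hspec.1, by rwa [length_prefixList], by
          rw [take_prefixList ω hjk]; exact hspec.2⟩, fun n hn hHn => Nat.find_min h hn ⟨hHn.1, ?_⟩⟩
        simpa [take_prefixList ω (hn.le.trans hjk)] using hHn.2.2
      rw [hN1 _ h', hfind, take_prefixList ω hjk]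
      exact hj
    · push Not at h
      filter_upwards [hns ω hω h r hr] with j hj
      have h' : ¬ ∃ k, H (prefixList ω j) k := by
        rintro ⟨k, h1, h2, h3⟩
        rw [length_prefixList] at h2
        rw [take_prefixList ω h2] at h3
        exact h k h1 h3
      rw [hN2 _ h']
      linarith
  exact (gameUpper_le (fun ω => (hf ω).1) hhedge).trans
    (hle t fun k hk hH => absurd hH.1 (not_le.2 hk))

end Supermartingale
/-! ### Lévy's zero-one law and monotone convergence -/

section Levy

variable {X : Type} [Fintype X] [Nonempty X] {Q : UpperExpTree X} {f : Path X → ℝ} {D : ℝ}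

/-- The paths along which the conditional upper expectation of `f` keeps dropping below `a`
although `f` exceeds `b`. -/
def droppingPaths (Q : UpperExpTree X) (f : Path X → ℝ) (a b : ℝ) : Set (Path X) :=
  {ω | (∃ᶠ k in atTop, gameUpper Q f (prefixList ω k) < a) ∧ b < f ω}

lemma indicator_const_bounds {α : Type*} (A : Set α) (hD : 0 ≤ D) (ω : α) :
    0 ≤ A.indicator (fun _ => D) ω ∧ A.indicator (fun _ => D) ω ≤ D := by
  by_cases h : ω ∈ A <;> simp [h, hD]

lemma gameUpper_droppingPaths_nonpos (hf : ∀ ω, 0 ≤ f ω ∧ f ω ≤ D) {a b : ℝ} (ha : 0 < a)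
    (hab : a < b) (t : List X) :
    gameUpper Q ((droppingPaths Q f a b).indicator fun _ => D) t ≤ 0 := by
  set A := droppingPaths Q f a b with hA
  have hb : 0 < b := ha.trans hab
  have hD : 0 ≤ D := (hf (extendPath t)).1.trans (hf _).2
  have hAb := indicator_const_bounds (α := Path X) A hD
  set q := gameUpper Q (A.indicator fun _ => D) with hq
  have hqb : ∀ t, 0 ≤ q t ∧ q t ≤ D := gameUpper_mem_bounds hAb
  have hbdd : BddAbove (Set.range q) := ⟨D, by rintro _ ⟨t, rfl⟩; exact (hqb t).2⟩
  set θ := ⨆ t, q t with hθ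
  have hqθ : ∀ t, q t ≤ θ := le_ciSup hbdd
  have hθ0 : 0 ≤ θ := (hqb t).1.trans (hqθ t)
  have hnotA : ∀ ω, ω ∉ A → A.indicator (fun _ => D) ω = 0 := fun ω h => by simp [h]
  have low : ∀ u, gameUpper Q f u < a → q u ≤ θ / b * a := by
    intro u hu
    obtain ⟨M, hM, hMb, hMu⟩ := exists_superhedges_lt hf hu
    have hθb : 0 ≤ θ / b := by positivity
    refine (gameUpper_le_of_stopping (M := fun v => θ / b * M v) hAb (hM.1.const_mul hθb)
      ⟨0, fun v => mul_nonneg hθb (hMb v).1⟩ {v | b ≤ M v} (fun v hv => (hqθ v).trans ?_)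
      fun ω hω hk r hr => ?_).trans (mul_le_mul_of_nonneg_left hMu.le hθb)
    · have := mul_le_mul_of_nonneg_left (show b ≤ M v from hv) hθb
      rwa [div_mul_cancel₀ _ hb.ne'] at this
    · have hωA : ω ∉ A := fun hωA => by
        obtain ⟨k, h1, h2⟩ :=
          ((hM.2.2 ω hω b hωA.2).and (eventually_ge_atTop u.length)).exists
        exact hk k h2 h1.le
      rw [hnotA ω hωA] at hr
      exact Eventually.of_forall fun k => hr.trans_le (mul_nonneg hθb (hMb _).1)
  have all : ∀ u, q u ≤ θ / b * a := by
    intro u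
    refine gameUpper_le_of_stopping (M := fun _ => θ / b * a) hAb (isSupermart_const _)
      ⟨_, fun _ => le_rfl⟩ {v | gameUpper Q f v < a} low fun ω hω hk r hr => ?_
    have hωA : ω ∉ A := fun hωA => by
      obtain ⟨k, h1, h2⟩ := (hωA.1.and_eventually (eventually_ge_atTop u.length)).exists
      exact hk k h2 h1
    rw [hnotA ω hωA] at hr
    exact Eventually.of_forall fun k => hr.trans_le (by positivity)
  have hθle : θ ≤ θ / b * a := ciSup_le all
  have : θ ≤ 0 := by
    rw [div_mul_eq_mul_div, le_div_iff₀ hb] at hθle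
    nlinarith
  exact (hqθ t).trans this

/-- Continuity from below of the game-theoretic upper expectation on gambles. -/
lemma gameUpper_le_of_monotone {fn : ℕ → Path X → ℝ} {s : List X} {c : ℝ} (hmono : Monotone fn)
    (hfn : ∀ n ω, 0 ≤ fn n ω ∧ fn n ω ≤ D) (hf : ∀ ω, 0 ≤ f ω ∧ f ω ≤ D)
    (hlim : ∀ ω, ∀ r < f ω, ∃ n, r < fn n ω) (hc : ∀ n, gameUpper Q (fn n) s ≤ c) :
    gameUpper Q f s ≤ c := by
  have hD : 0 ≤ D := (hf (extendPath s)).1.trans (hf _).2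
  refine le_of_forall_pos_le_add fun ε hε => ?_
  let ι := {i : ℕ × ℚ × ℚ // 0 < i.2.1 ∧ i.2.1 < i.2.2}
  have : Nonempty ι := ⟨⟨(0, 1, 2), by norm_num⟩⟩
  obtain ⟨e, he⟩ : ∃ e : ℕ → ι, Function.Surjective e := exists_surjective_nat ι
  obtain ⟨w, hw0, cw, hcw, hcwε⟩ := posSumOfEncodable hε ℕ
  have hT : ∀ i : ℕ, ∃ T : List X → ℝ,
      Superhedges Q ((droppingPaths Q (fn (e i).1.1) (e i).1.2.1 (e i).1.2.2).indicator
        fun _ => D) s T ∧ (∀ t, 0 ≤ T t ∧ T t ≤ D) ∧ T s < w i := fun i =>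
    exists_superhedges_lt (indicator_const_bounds _ hD)
      ((gameUpper_droppingPaths_nonpos (hfn _) (by exact_mod_cast (e i).2.1)
        (by exact_mod_cast (e i).2.2) s).trans_lt (hw0 i))
  choose T hTs hTb hTw using hT
  let M : ℕ → List X → ℝ := fun n t =>
    min (gameUpper Q (fn n) t + ∑ i ∈ Finset.range n, T i t) D
  have hMsuper : ∀ n, IsSupermart Q (M n) := fun n =>
    ((isSupermart_gameUpper (hfn n)).add (IsSupermart.sum _ fun i => (hTs i).1)).min_const D
  have hEmono : ∀ t, Monotone fun n => gameUpper Q (fn n) t := fun t m n hmn =>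
    gameUpper_mono (fun ω => (hfn m ω).1) (fun ω => (hfn n ω).2) (hmono hmn) t
  have hMmono : ∀ t, Monotone fun n => M n t := fun t m n hmn =>
    min_le_min_right _ (add_le_add (hEmono t hmn)
      (Finset.sum_le_sum_of_subset_of_nonneg (Finset.range_mono hmn) fun i _ _ => (hTb i t).1))
  have hMD : ∀ n t, M n t ≤ D := fun n t => min_le_right _ _
  have hE0 : ∀ n t, 0 ≤ gameUpper Q (fn n) t := fun n t => (gameUpper_mem_bounds (hfn n) t).1
  have hT0 : ∀ n t, 0 ≤ ∑ i ∈ Finset.range n, T i t := fun n t =>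
    Finset.sum_nonneg fun i _ => (hTb i t).1
  have hM0 : ∀ n t, 0 ≤ M n t := fun n t => le_min (add_nonneg (hE0 n t) (hT0 n t)) hD
  have hbdd : ∀ t, BddAbove (Set.range fun n => M n t) := fun t =>
    ⟨D, by rintro _ ⟨n, rfl⟩; exact hMD n t⟩
  let L : List X → ℝ := fun t => ⨆ n, M n t
  have hML : ∀ n t, M n t ≤ L t := fun n t => le_ciSup (hbdd t) n
  have hL : Superhedges Q f s L := by
    refine ⟨IsSupermart.of_tendsto hMsuper fun t => tendsto_atTop_ciSup (hMmono t) (hbdd t),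
      ⟨0, fun t => (hM0 0 t).trans (hML 0 t)⟩, fun ω hω r hr => ?_⟩
    by_cases hA : ∃ i, ω ∈ droppingPaths Q (fn (e i).1.1) (e i).1.2.1 (e i).1.2.2
    · obtain ⟨i, hi⟩ := hA
      filter_upwards [(hTs i).2.2 ω hω r (by simpa [hi] using hr.trans_le (hf ω).2)] with k hk
      refine (lt_min ?_ (hr.trans_le (hf ω).2)).trans_le (hML (i + 1) _)
      have := Finset.single_le_sum (f := fun i => T i (prefixList ω k))
        (fun j _ => (hTb j _).1) (Finset.self_mem_range_succ i)
      linarith [hE0 (i + 1) (prefixList ω k)]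
    · obtain ⟨n, hn⟩ := hlim ω r hr
      by_contra hcon
      have hfreq : ∃ᶠ k in atTop, L (prefixList ω k) ≤ r := by
        simpa [Filter.Frequently, not_le] using hcon
      have hr0 : 0 ≤ r := by
        obtain ⟨k, hk⟩ := hfreq.exists
        exact ((hM0 0 _).trans (hML 0 _)).trans hk
      obtain ⟨a, ha1, ha2⟩ := exists_rat_btwn hn
      obtain ⟨b, hb1, hb2⟩ := exists_rat_btwn ha2
      obtain ⟨i, hi⟩ := he ⟨(n, a, b), by exact_mod_cast hr0.trans_lt ha1, by exact_mod_cast hb1⟩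
      refine hA ⟨i, ?_⟩
      rw [hi]
      refine ⟨hfreq.mono fun k hk => ?_, hb2⟩
      have h1 : min (gameUpper Q (fn n) (prefixList ω k)) D ≤ r :=
        (min_le_min_right _ (le_add_of_nonneg_right (hT0 n _))).trans ((hML n _).trans hk)
      rcases min_le_iff.1 h1 with h2 | h2
      · exact h2.trans_lt ha1
      · linarith [(hf ω).2]
  refine (gameUpper_le (fun ω => (hf ω).1) hL).trans (ciSup_le fun n => ?_)
  refine (min_le_left _ _).trans (add_le_add (hc n) ?_)
  refine (Finset.sum_le_sum fun i _ => (hTw i).le).trans ?_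
  exact (sum_le_hasSum _ (fun i _ => (hw0 i).le) hcw).trans hcwε

end Levy
/-! ### Tree measures -/

section TreeMeasure

lemma measurableSet_cyl {X : Type} (z : List X) : MeasurableSet (cyl z) :=
  MeasurableSpace.measurableSet_generateFrom ⟨z, rfl⟩

lemma ofFn_eq_prefixList_iff {X : Type} {ω : Path X} {k : ℕ} {v : Fin k → X} :
    List.ofFn v = prefixList ω k ↔ v = fun i : Fin k => ω i := by
  have : prefixList ω k = List.ofFn fun i : Fin k => ω i := by
    apply List.ext_getElem <;> simp [prefixList]
  rw [this, List.ofFn_inj]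

variable {X : Type} [Fintype X]

lemma measurable_comp_prefixList {β : Type*} [MeasurableSpace β] (g : List X → β) (k : ℕ) :
    Measurable fun ω : Path X => g (prefixList ω k) := by
  intro S _
  have : (fun ω : Path X => g (prefixList ω k)) ⁻¹' S =
      ⋃ z ∈ {z : List X | z.length = k ∧ g z ∈ S}, cyl z := by
    ext ω
    simp only [Set.mem_preimage, Set.mem_iUnion, Set.mem_ofPred_eq, exists_prop]
    constructor
    · exact fun h => ⟨_, ⟨length_prefixList ω k, h⟩, mem_cyl_prefixList ω k⟩
    · rintro ⟨z, ⟨rfl, h⟩, hz⟩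
      rwa [show prefixList ω z.length = z from hz]
  rw [this]
  exact MeasurableSet.biUnion (Set.to_countable _) fun z _ => measurableSet_cyl z

lemma integrable_comp_prefixList (μ : Measure (Path X)) [IsProbabilityMeasure μ]
    (g : List X → ℝ) (k : ℕ) : Integrable (fun ω => g (prefixList ω k)) μ := by
  obtain ⟨C, hC⟩ := (Set.finite_range fun v : Fin k → X => ‖g (List.ofFn v)‖).bddAbove
  refine Integrable.of_bound (measurable_comp_prefixList g k).aestronglyMeasurable C
    (Eventually.of_forall fun ω => ?_)
  rw [← ofFn_eq_prefixList_iff.2 rfl]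
  exact hC ⟨_, rfl⟩

lemma integral_comp_prefixList (μ : Measure (Path X)) [IsProbabilityMeasure μ]
    (g : List X → ℝ) (k : ℕ) :
    ∫ ω, g (prefixList ω k) ∂μ = ∑ v : Fin k → X, μ.real (cyl (List.ofFn v)) * g (List.ofFn v) := by
  classical
  have h : ∀ ω : Path X, g (prefixList ω k) =
      ∑ v : Fin k → X, (cyl (List.ofFn v)).indicator (fun _ => g (List.ofFn v)) ω := by
    intro ω
    rw [Finset.sum_eq_single fun i : Fin k => ω i]
    · rw [ofFn_eq_prefixList_iff.2 rfl, Set.indicator_of_mem (mem_cyl_prefixList ω k)]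
    · intro v _ hv
      rw [Set.indicator_of_notMem]
      intro hmem
      have : prefixList ω (List.ofFn v).length = List.ofFn v := hmem
      rw [List.length_ofFn] at this
      exact hv (ofFn_eq_prefixList_iff.1 this.symm)
    · simp
  simp_rw [h]
  rw [integral_finsetSum _ fun v _ =>
    (integrable_const _).indicator (measurableSet_cyl _)]
  simp [integral_indicator_const, measurableSet_cyl]

lemma cylProb_append_singleton {X : Type} [Nonempty X] [DecidableEq X]
    (p : List X → X → ℝ) {s z : List X} (h : s.length ≤ z.length)
    (x : X) : cylProb p s (z ++ [x]) = cylProb p s z * p z x := by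
  have hlt : s.length < (z ++ [x]).length := by simp; omega
  have hprod : ∏ i ∈ Finset.Ico s.length (z ++ [x]).length, p ((z ++ [x]).take i)
      ((z ++ [x]).getD i (Classical.arbitrary X)) =
      (∏ i ∈ Finset.Ico s.length z.length, p (z.take i) (z.getD i (Classical.arbitrary X))) *
        p z x := by
    rw [List.length_append, List.length_singleton, Finset.prod_Ico_succ_top h]
    congr 1
    · refine Finset.prod_congr rfl fun i hi => ?_
      have hi' := (Finset.mem_Ico.1 hi).2
      rw [List.take_append_of_le_length hi'.le, List.getD_append _ _ _ _ hi']
    · simp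
  unfold cylProb
  rw [List.take_append_of_le_length h, hprod]
  by_cases hz : z.take s.length = s
  · rw [if_pos ⟨hlt, hz⟩]
    rcases h.lt_or_eq with h' | h'
    · rw [if_pos ⟨h', hz⟩]
    · have : z = s := by rw [← hz, h', List.take_length]
      subst this
      simp
  · have h2 : ¬ (z.length ≤ s.length ∧ s.take z.length = z) := by
      rintro ⟨h1, h2⟩
      apply hz
      have h3 : s.length = z.length := le_antisymm h h1
      rw [h3, List.take_length]
      rw [← h3, List.take_length] at h2
      exact h2.symm
    rw [if_neg fun h => hz h.2, if_neg fun h => absurd hlt (not_lt.2 h.1),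
      if_neg fun h => hz h.2, if_neg h2, zero_mul]

lemma cylProb_self {X : Type} [Nonempty X] [DecidableEq X] (p : List X → X → ℝ) (s : List X) :
    cylProb p s s = 1 := by
  simp [cylProb]

variable [Nonempty X] [DecidableEq X]

/-- The one-step expectation operator of a family of mass functions. -/
def stepExp (p : List X → X → ℝ) (g : List X → ℝ) (t : List X) : ℝ :=
  ∑ x, g (t ++ [x]) * p t x

variable {p : PreciseTree X} {s : List X} {μ : Measure (Path X)}

lemma cylProb_nonneg (p : PreciseTree X) (s z : List X) : 0 ≤ cylProb p.p s z := by
  unfold cylProb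
  split_ifs
  · exact Finset.prod_nonneg fun _ _ => p.nonneg _ _
  · exact zero_le_one
  · exact le_rfl

lemma IsTreeMeasure.integral_succ (h : IsTreeMeasure p s μ) (g : List X → ℝ) {k : ℕ}
    (hk : s.length ≤ k) :
    ∫ ω, g (prefixList ω (k + 1)) ∂μ = ∫ ω, stepExp p.p g (prefixList ω k) ∂μ := by
  have := h.1
  have hreal : ∀ z, μ.real (cyl z) = cylProb p.p s z := fun z => by
    rw [measureReal_def, h.2 z, ENNReal.toReal_ofReal (cylProb_nonneg p s z)]
  rw [integral_comp_prefixList, integral_comp_prefixList,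
    ← (Fin.snocEquiv fun _ : Fin (k + 1) => X).sum_comp, Fintype.sum_prod_type, Finset.sum_comm]
  refine Finset.sum_congr rfl fun v _ => ?_
  rw [stepExp, Finset.mul_sum]
  refine Finset.sum_congr rfl fun x _ => ?_
  have hsnoc : List.ofFn ((Fin.snocEquiv fun _ : Fin (k + 1) => X) (x, v)) =
      List.ofFn v ++ [x] := by
    rw [List.ofFn_succ']
    simp [Fin.snocEquiv, List.concat_eq_append]
  rw [hsnoc, hreal, hreal, cylProb_append_singleton p.p (by simpa using hk)]
  ring

lemma IsTreeMeasure.ae_mem_cyl (h : IsTreeMeasure p s μ) : ∀ᵐ ω ∂μ, ω ∈ cyl s := by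
  have := h.1
  have h1 : μ (cyl s) = 1 := by rw [h.2 s, cylProb_self, ENNReal.ofReal_one]
  exact (prob_compl_eq_zero_iff (measurableSet_cyl s)).2 h1

lemma IsTreeMeasure.integral_iterate (h : IsTreeMeasure p s μ) (g : List X → ℝ) (m : ℕ) :
    ∫ ω, g (prefixList ω (s.length + m)) ∂μ = (stepExp p.p)^[m] g s := by
  have := h.1
  induction m generalizing g with
  | zero =>
    have : (fun ω => g (prefixList ω s.length)) =ᵐ[μ] fun _ => g s := by
      filter_upwards [h.ae_mem_cyl] with ω hω
      rw [show prefixList ω s.length = s from hω]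
    simpa using integral_congr_ae this
  | succ m ih =>
    rw [← add_assoc, h.integral_succ g (Nat.le_add_right _ _), ih, Function.iterate_succ_apply]

end TreeMeasure
/-! ### Comparison of the two upper expectations on bounded functions -/

section Comparison

variable {X : Type} [Fintype X] [Nonempty X] [DecidableEq X] {P : ImpreciseTree X}
  {Q : UpperExpTree X} {p : PreciseTree X} {s : List X} {μ : Measure (Path X)} {b c : ℝ}

lemma ImpreciseTree.sum_mul_le {X : Type} [Fintype X] (P : ImpreciseTree X) {t : List X}
    {q : X → ℝ} {c : ℝ} (hq : q ∈ P.sets t) {f : X → ℝ} (hf : ∀ x, f x ≤ c) : ∑ x, f x * q x ≤ c := by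
  obtain ⟨h0, h1⟩ := P.prob' t q hq
  calc ∑ x, f x * q x ≤ ∑ x, c * q x :=
        Finset.sum_le_sum fun x _ => mul_le_mul_of_nonneg_right (hf x) (h0 x)
    _ = c := by rw [← Finset.mul_sum, h1, mul_one]

lemma ImpreciseTree.isCompact_sets {X : Type} [Fintype X] (P : ImpreciseTree X) (t : List X) :
    IsCompact (P.sets t) := by
  refine (isCompact_univ_pi fun _ : X => isCompact_Icc (a := (0 : ℝ)) (b := 1)).of_isClosed_subset
    (P.closed' t) fun q hq x _ => ?_
  obtain ⟨h0, h1⟩ := P.prob' t q hq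
  exact ⟨h0 x, h1 ▸ Finset.single_le_sum (f := q) (fun y _ => h0 y) (Finset.mem_univ x)⟩

lemma Agree.sum_mul_le {X : Type} [Fintype X] [Nonempty X] {P : ImpreciseTree X}
    {Q : UpperExpTree X} (h : Agree P Q) {t : List X} {q : X → ℝ} (hq : q ∈ P.sets t)
    (f : X → ℝ) : ∑ x, f x * q x ≤ Q.Q t f := by
  rw [h t f]
  refine le_csSup ⟨⨆ x, f x, ?_⟩ ⟨q, hq, rfl⟩
  rintro _ ⟨q', hq', rfl⟩
  exact P.sum_mul_le hq' fun x => le_ciSup (Set.finite_range f).bddAbove x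

lemma Agree.exists_sum_mul_eq {X : Type} [Fintype X] [Nonempty X] {P : ImpreciseTree X}
    {Q : UpperExpTree X} (h : Agree P Q) (t : List X) (f : X → ℝ) :
    ∃ q ∈ P.sets t, Q.Q t f = ∑ x, f x * q x := by
  have hcont : Continuous fun q : X → ℝ => ∑ x, f x * q x := by fun_prop
  obtain ⟨q, hq, hmax⟩ :=
    (P.isCompact_sets t).exists_isMaxOn (P.nonempty' t) hcont.continuousOn
  refine ⟨q, hq, le_antisymm ?_ (h.sum_mul_le hq f)⟩
  rw [h t f]
  refine csSup_le ⟨_, q, hq, rfl⟩ ?_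
  rintro _ ⟨q', hq', rfl⟩
  exact hmax hq'

lemma IsTreeMeasure.integral_supermart_le (hμ : IsTreeMeasure p s μ) (hp : Compatible p P)
    (h : Agree P Q) {M : List X → ℝ} (hM : IsSupermart Q M) (m : ℕ) :
    ∫ ω, M (prefixList ω (s.length + m)) ∂μ ≤ M s := by
  have := hμ.1
  induction m with
  | zero => exact (hμ.integral_iterate M 0).le
  | succ m ih =>
    rw [← add_assoc, hμ.integral_succ M (Nat.le_add_right _ _)]
    refine (integral_mono (integrable_comp_prefixList μ _ _) (integrable_comp_prefixList μ _ _)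
      fun ω => ?_).trans ih
    exact (h.sum_mul_le (hp _) _).trans (hM _)

/-- Fatou's argument: expectations are dominated by the game-theoretic upper expectation. -/
lemma IsTreeMeasure.integral_le_gameUpper (hμ : IsTreeMeasure p s μ) (hp : Compatible p P)
    (h : Agree P Q) {f : Path X → ℝ} (hfm : Measurable f) (hf : ∀ ω, b ≤ f ω ∧ f ω ≤ c) :
    ∫ ω, f ω ∂μ ≤ gameUpper Q f s := by
  have := hμ.1
  have hint : ∀ {g : Path X → ℝ} {b c : ℝ}, Measurable g → (∀ ω, b ≤ g ω ∧ g ω ≤ c) →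
      Integrable g μ := fun {g b c} hg hb =>
    Integrable.of_mem_Icc b c hg.aemeasurable (Eventually.of_forall hb)
  refine le_of_forall_gt_imp_ge_of_dense fun r hr => ?_
  obtain ⟨M, hM, hMb, hMr⟩ := exists_superhedges_lt hf hr
  let N : ℕ → Path X → ℝ := fun m ω => M (prefixList ω (s.length + m))
  have hNm : ∀ m, Measurable (N m) := fun m => measurable_comp_prefixList M _
  let d : ℕ → Path X → ℝ := fun m ω => max (f ω - N m ω) 0
  have hdm : ∀ m, Measurable (d m) := fun m => (hfm.sub (hNm m)).max measurable_const
  have hd : ∀ m ω, 0 ≤ d m ω ∧ d m ω ≤ c - b := fun m ω => by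
    have h1 := hf ω
    have h2 := hMb (prefixList ω (s.length + m))
    exact ⟨le_max_right _ _, max_le (by simp only [N]; linarith) (by linarith)⟩
  have hlim : Tendsto (fun m => ∫ ω, d m ω ∂μ) atTop (𝓝 (∫ _, (0 : ℝ) ∂μ)) := by
    refine tendsto_integral_of_dominated_convergence (fun _ => c - b)
      (fun m => (hdm m).aestronglyMeasurable) (integrable_const _)
      (fun m => Eventually.of_forall fun ω => ?_) ?_
    · rw [Real.norm_of_nonneg (hd m ω).1]
      exact (hd m ω).2
    · filter_upwards [hμ.ae_mem_cyl] with ω hω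
      rw [Metric.tendsto_nhds]
      intro ε hε
      have hev := hM.2.2 ω hω (f ω - ε) (sub_lt_self _ hε)
      filter_upwards [(tendsto_add_atTop_nat s.length).eventually hev] with m hm
      rw [add_comm] at hm
      rw [Real.dist_0_eq_abs, abs_of_nonneg (hd m ω).1]
      exact max_lt (by simp only [N]; linarith) hε
  rw [integral_zero] at hlim
  have hlim2 := hlim.const_add (M s)
  rw [add_zero] at hlim2
  refine (ge_of_tendsto' hlim2 fun m => ?_).trans hMr.le
  calc ∫ ω, f ω ∂μ ≤ ∫ ω, (N m ω + d m ω) ∂μ :=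
        integral_mono (hint hfm hf) ((hint (hNm m) fun ω => hMb _).add (hint (hdm m) (hd m)))
          fun ω => by
            have := le_max_left (f ω - N m ω) 0
            simp only [d]
            linarith
    _ = ∫ ω, N m ω ∂μ + ∫ ω, d m ω ∂μ :=
        integral_add (hint (hNm m) fun ω => hMb _) (hint (hdm m) (hd m))
    _ ≤ M s + ∫ ω, d m ω ∂μ := by
        gcongr
        exact hμ.integral_supermart_le hp h hM.1 m

/-- Backward induction: on finitary gambles the game-theoretic upper expectation is attained by
a family of mass functions from the local credal sets. -/
lemma Agree.exists_gameUpper_le_iterate {X : Type} [Fintype X] [Nonempty X] {P : ImpreciseTree X}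
    {Q : UpperExpTree X} (h : Agree P Q) (s : List X) (m : ℕ) {G : List X → ℝ}
    (hG : ∀ t x, s.length + m ≤ t.length → G (t ++ [x]) = G t) (hGb : ∀ t, b ≤ G t ∧ G t ≤ c) :
    ∃ q : List X → X → ℝ, (∀ t, q t ∈ P.sets t) ∧
      gameUpper Q (fun ω => G (prefixList ω (s.length + m))) s ≤ (stepExp q)^[m] G s := by
  set N := s.length + m with hN
  let U : (List X → ℝ) → List X → ℝ := fun W t => Q.Q t fun x => W (t ++ [x])
  let V : List X → ℝ := fun t => U^[N - t.length] G t
  have hVstep : ∀ t, t.length < N → V t = Q.Q t fun x => V (t ++ [x]) := by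
    intro t ht
    have h1 : N - t.length = (N - (t.length + 1)) + 1 := by omega
    simp only [V, h1, Function.iterate_succ_apply', List.length_append, List.length_singleton, U]
  have hVG : ∀ t, N ≤ t.length → V t = G t := by
    intro t ht
    simp [V, Nat.sub_eq_zero_of_le ht]
  have hbU : ∀ j t, b ≤ U^[j] G t := by
    intro j
    induction j with
    | zero => exact fun t => (hGb t).1
    | succ j ih =>
      intro t
      rw [Function.iterate_succ_apply']
      exact Q.ge_of_forall_ge t fun x => ih _
  choose q hq hqmax using fun t => h.exists_sum_mul_eq t fun x => V (t ++ [x])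
  refine ⟨q, hq, ?_⟩
  have hqV : ∀ j t, t.length + j = N → (stepExp q)^[j] G t = V t := by
    intro j
    induction j with
    | zero => exact fun t ht => (hVG t (by omega)).symm
    | succ j ih =>
      intro t ht
      rw [Function.iterate_succ_apply', hVstep t (by omega), hqmax]
      refine Finset.sum_congr rfl fun x _ => ?_
      rw [ih (t ++ [x]) (by simp; omega)]
  rw [hqV m s rfl]
  refine gameUpper_le (fun ω => (hGb _).1) ⟨fun t => ?_, ⟨b, fun t => hbU _ t⟩, fun ω _ r hr => ?_⟩
  · rcases lt_or_ge t.length N with ht | ht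
    · exact (hVstep t ht).ge
    · refine Q.le_of_forall_le t fun x => ?_
      rw [hVG t ht, hVG (t ++ [x]) (by simp; omega), hG t x ht]
  · filter_upwards [eventually_ge_atTop N] with k hk
    have : G (prefixList ω k) = G (prefixList ω N) := by
      induction k, hk using Nat.le_induction with
      | base => rfl
      | succ k hk ih => rw [prefixList_succ, hG _ _ (by rwa [length_prefixList]), ih]
    rw [hVG _ (by rwa [length_prefixList]), this]
    exact hr

lemma continuous_stepExp_iterate {X : Type} [Fintype X] (G : List X → ℝ) (m : ℕ)
    (t : List X) :
    Continuous fun q : List X → X → ℝ => (stepExp q)^[m] G t := by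
  induction m generalizing t with
  | zero => exact continuous_const
  | succ m ih =>
    simp_rw [Function.iterate_succ_apply', stepExp]
    exact continuous_finsetSum _ fun x _ => (ih _).mul (by fun_prop)

/-- Compactness of the set of compatible trees: one tree handles a whole nonincreasing sequence
of finitary gambles. -/
lemma Agree.exists_compatible_le_integral (h : Agree P Q)
    {Pm : PreciseTree X → List X → Measure (Path X)}
    (hPm : ∀ (p : PreciseTree X) (s : List X), IsTreeMeasure p s (Pm p s))
    {hn : ℕ → Path X → ℝ} (hanti : Antitone hn)
    (hfin : ∀ n, ∃ N, ∀ ω ω', prefixList ω N = prefixList ω' N → hn n ω = hn n ω')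
    (hbdd : ∀ n, ∃ b c, ∀ ω, b ≤ hn n ω ∧ hn n ω ≤ c) {a : ℝ}
    (ha : ∀ n, a ≤ gameUpper Q (hn n) s) :
    ∃ p : PreciseTree X, Compatible p P ∧ ∀ n, a ≤ ∫ ω, hn n ω ∂(Pm p s) := by
  choose m hm using hfin
  choose b c hbc using hbdd
  let G : ℕ → List X → ℝ := fun n t => hn n (extendPath (t.take (s.length + m n)))
  have hGn : ∀ n, hn n = fun ω => G n (prefixList ω (s.length + m n)) := by
    intro n
    ext ω
    refine hm n _ _ ?_
    rw [take_prefixList ω le_rfl]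
    have h1 := prefixList_extendPath (prefixList ω (s.length + m n))
    rw [length_prefixList] at h1
    have h2 := congrArg (List.take (m n)) h1
    rwa [take_prefixList _ (Nat.le_add_left _ _), take_prefixList _ (Nat.le_add_left _ _),
      eq_comm] at h2
  have hint : ∀ (p : PreciseTree X) n,
      ∫ ω, hn n ω ∂(Pm p s) = (stepExp p.p)^[m n] (G n) s := fun p n => by
    rw [hGn n]
    exact (hPm p s).integral_iterate (G n) (m n)
  let K : Set (List X → X → ℝ) := Set.univ.pi P.sets
  have hK : IsCompact K := isCompact_univ_pi P.isCompact_sets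
  let tree : ∀ q ∈ K, PreciseTree X := fun q hq =>
    ⟨q, fun t => (P.prob' t _ (hq t trivial)).1, fun t => (P.prob' t _ (hq t trivial)).2⟩
  let S : ℕ → Set (List X → X → ℝ) := fun n => K ∩ {q | a ≤ (stepExp q)^[m n] (G n) s}
  have hSc : ∀ n, IsClosed (S n) := fun n =>
    hK.isClosed.inter (isClosed_le continuous_const (continuous_stepExp_iterate _ _ _))
  have hSanti : ∀ n, S (n + 1) ⊆ S n := by
    rintro n q ⟨hqK, hq⟩
    refine ⟨hqK, le_trans (show a ≤ _ from hq) ?_⟩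
    rw [← hint (tree q hqK), ← hint (tree q hqK)]
    have := (hPm (tree q hqK) s).1
    refine integral_mono ?_ ?_ (hanti n.le_succ)
    · rw [hGn]; exact integrable_comp_prefixList _ _ _
    · rw [hGn]; exact integrable_comp_prefixList _ _ _
  have hSne : ∀ n, (S n).Nonempty := by
    intro n
    obtain ⟨q, hq, hle⟩ := h.exists_gameUpper_le_iterate s (m n) (G := G n)
      (fun t x ht => by simp only [G]; rw [List.take_append_of_le_length ht]) (fun t => hbc n _)
    refine ⟨q, fun t _ => hq t, (ha n).trans ?_⟩
    conv_lhs => rw [hGn n]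
    exact hle
  obtain ⟨q, hq⟩ := IsCompact.nonempty_iInter_of_sequence_nonempty_isCompact_isClosed S hSanti
    hSne (hK.of_isClosed_subset (hSc 0) Set.inter_subset_left) hSc
  have hq' := Set.mem_iInter.1 hq
  refine ⟨tree q (hq' 0).1, fun t => (hq' 0).1 t trivial, fun n => ?_⟩
  rw [hint]
  exact (hq' n).2

end Comparison
/-! ### Capacitability of measurable gambles -/

section Capacitability

lemma borelSpace_path {X : Type} [Fintype X] [Nonempty X] [TopologicalSpace X]
    [DiscreteTopology X] : BorelSpace (Path X) := by
  refine ⟨?_⟩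
  rw [(PiNat.isTopologicalBasis_cylinders fun _ : ℕ => X).borel_eq_generateFrom]
  change MeasurableSpace.generateFrom _ = _
  congr 1
  have key : ∀ (x : Path X) n, cyl (prefixList x n) = PiNat.cylinder x n := by
    intro x n
    ext ω
    simp only [cyl, length_prefixList, Set.mem_ofPred_eq, PiNat.cylinder]
    exact prefixList_eq_iff
  ext A
  constructor
  · rintro ⟨z, rfl⟩
    exact ⟨extendPath z, z.length, by rw [← key, prefixList_extendPath]⟩
  · rintro ⟨x, n, rfl⟩
    exact ⟨prefixList x n, (key x n).symm⟩

/-- A measurable function becomes continuous along a continuous parametrization of the path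
space by the Baire space. -/
lemma exists_continuous_parametrization {X : Type} [Fintype X] [Nonempty X] [TopologicalSpace X]
    [DiscreteTopology X] {f : Path X → ℝ} (hf : Measurable f) :
    ∃ π : (ℕ → ℕ) → Path X, Function.Surjective π ∧ Continuous π ∧ Continuous (f ∘ π) := by
  have := borelSpace_path (X := X)
  have : Countable X := Finite.to_countable
  have : PolishSpace X := inferInstance
  have : PolishSpace (Path X) := inferInstanceAs (PolishSpace (ℕ → X))
  obtain ⟨t', ht', hft', hpol⟩ := hf.exists_continuous
  obtain ⟨π, hπ, hsurj⟩ := @PolishSpace.exists_nat_nat_continuous_surjective (Path X) t' hpol _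
  exact ⟨π, hsurj, continuous_le_rng ht' hπ, @Continuous.comp _ _ _ _ t' _ _ _ hft' hπ⟩

/-- A sequence whose initial coordinates are eventually dominated by `m` has a subsequence
converging to a point dominated by `m`. -/
lemma exists_tendsto_subseq_of_le {m : ℕ → ℕ} {σ : ℕ → ℕ → ℕ} (hσ : ∀ n, ∀ i < n, σ n i ≤ m i) :
    ∃ (τ : ℕ → ℕ) (φ : ℕ → ℕ), StrictMono φ ∧ Tendsto (σ ∘ φ) atTop (𝓝 τ) := by
  let B : ℕ → ℕ := fun i => m i + ∑ n ∈ Finset.range (i + 1), σ n i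
  have hcomp : IsCompact (Set.univ.pi fun i => Set.Iic (B i)) :=
    isCompact_univ_pi fun i => (Set.finite_Iic (B i)).isCompact
  obtain ⟨τ, -, φ, hφ, hτ⟩ := hcomp.tendsto_subseq (x := σ) fun n i _ => by
    rcases lt_or_ge i n with h | h
    · exact (hσ n i h).trans (Nat.le_add_right _ _)
    · exact (Finset.single_le_sum (f := fun n => σ n i) (fun _ _ => Nat.zero_le _)
        (Finset.mem_range.2 (Nat.lt_succ_of_le h))).trans (Nat.le_add_left _ _)
  exact ⟨τ, φ, hφ, hτ⟩

lemma le_integral_of_antitone {α : Type*} [MeasurableSpace α] {μ : Measure α}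
    [IsProbabilityMeasure μ] {g : ℕ → α → ℝ} {f : α → ℝ} {a b c : ℝ} (hg : Antitone g)
    (hgm : ∀ n, Measurable (g n)) (hgb : ∀ n ω, b ≤ g n ω ∧ g n ω ≤ c) (hf : Integrable f μ)
    (hle : ∀ ω r, (∀ n, r < g n ω) → r ≤ f ω) (ha : ∀ n, a ≤ ∫ ω, g n ω ∂μ) :
    a ≤ ∫ ω, f ω ∂μ := by
  have hbdd : ∀ ω, BddBelow (Set.range fun n => g n ω) := fun ω =>
    ⟨b, by rintro _ ⟨n, rfl⟩; exact (hgb n ω).1⟩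
  have hlim : ∀ ω, Tendsto (fun n => g n ω) atTop (𝓝 (⨅ n, g n ω)) := fun ω =>
    tendsto_atTop_ciInf (fun m n h => hg h ω) (hbdd ω)
  have hm : Measurable fun ω => ⨅ n, g n ω :=
    measurable_of_tendsto_metrizable hgm (tendsto_pi_nhds.2 hlim)
  have hint : Integrable (fun ω => ⨅ n, g n ω) μ :=
    Integrable.of_mem_Icc b c hm.aemeasurable (Eventually.of_forall fun ω =>
      ⟨le_ciInf fun n => (hgb n ω).1, (ciInf_le (hbdd ω) 0).trans (hgb 0 ω).2⟩)
  have hconv : Tendsto (fun n => ∫ ω, g n ω ∂μ) atTop (𝓝 (∫ ω, ⨅ n, g n ω ∂μ)) := by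
    refine tendsto_integral_of_dominated_convergence (fun _ => |b| + |c|)
      (fun n => (hgm n).aestronglyMeasurable) (integrable_const _)
      (fun n => Eventually.of_forall fun ω => ?_) (Eventually.of_forall hlim)
    rw [Real.norm_eq_abs, abs_le]
    constructor
    · linarith [(hgb n ω).1, neg_abs_le b, abs_nonneg c]
    · linarith [(hgb n ω).2, le_abs_self c, abs_nonneg b]
  refine (ge_of_tendsto' hconv ha).trans (integral_mono hint hf fun ω => ?_)
  exact le_of_forall_lt_imp_le_of_dense fun r hr =>
    hle ω r fun n => hr.trans_le (ciInf_le (hbdd ω) n)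

variable {X : Type} [Fintype X] [Nonempty X] [DecidableEq X] {P : ImpreciseTree X}
  {Q : UpperExpTree X} {s : List X} {f : Path X → ℝ} {b c D : ℝ}

/-- Choquet's argument: the game-theoretic upper expectation of a nonnegative measurable gamble
is approximated from below by expectations under compatible trees. -/
lemma Agree.exists_compatible_le_integral_of_nonneg (h : Agree P Q)
    {Pm : PreciseTree X → List X → Measure (Path X)}
    (hPm : ∀ (p : PreciseTree X) (s : List X), IsTreeMeasure p s (Pm p s))
    (hfm : Measurable f) (hf : ∀ ω, 0 ≤ f ω ∧ f ω ≤ D) (hc : c < gameUpper Q f s) :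
    ∃ p : PreciseTree X, Compatible p P ∧ c ≤ ∫ ω, f ω ∂(Pm p s) := by
  classical
  let _ : TopologicalSpace X := ⊥
  have : DiscreteTopology X := ⟨rfl⟩
  obtain ⟨π, hsurj, hπ, hfπ⟩ := exists_continuous_parametrization hfm
  let F : Set (ℕ → ℕ) → Path X → ℝ := fun A => (π '' A).indicator f
  have hF : ∀ A ω, 0 ≤ F A ω ∧ F A ω ≤ D := fun A ω => by
    by_cases hω : ω ∈ π '' A
    · simpa [F, Set.indicator_of_mem hω] using hf ω
    · simpa [F, Set.indicator_of_notMem hω] using (hf ω).1.trans (hf ω).2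
  have hFmono : ∀ {A B}, A ⊆ B → ∀ ω, F A ω ≤ F B ω := fun {A B} hAB ω =>
    Set.indicator_le_indicator_of_subset (Set.image_mono hAB) (fun ω => (hf ω).1) ω
  have step : ∀ (n : ℕ) (A : Set (ℕ → ℕ)), ∃ j, c < gameUpper Q (F A) s →
      c < gameUpper Q (F (A ∩ {σ | σ n ≤ j})) s := by
    intro n A
    by_contra! hcon
    refine absurd (hcon 0).1 (not_lt.2 ?_)
    refine gameUpper_le_of_monotone (fn := fun j => F (A ∩ {σ | σ n ≤ j})) ?_ (fun _ => hF _)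
      (hF A) (fun ω r hr => ?_) fun j => (hcon j).2
    · exact fun i j hij ω => hFmono
        (Set.inter_subset_inter_right _ fun σ (hσ : σ n ≤ i) => hσ.trans hij) ω
    · by_cases hω : ω ∈ π '' A
      · obtain ⟨σ, hσ, rfl⟩ := hω
        refine ⟨σ n, ?_⟩
        have h1 : π σ ∈ π '' A := ⟨σ, hσ, rfl⟩
        have h2 : π σ ∈ π '' (A ∩ {τ | τ n ≤ σ n}) := ⟨σ, ⟨hσ, le_refl (σ n)⟩, rfl⟩
        simp only [F, Set.indicator_of_mem h1] at hr
        simpa only [F, Set.indicator_of_mem h2] using hr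
      · refine ⟨0, hr.trans_le ?_⟩
        simpa only [F, Set.indicator_of_notMem hω] using (hF _ ω).1
  choose j hj using step
  let A : ℕ → Set (ℕ → ℕ) := fun n => Nat.rec Set.univ (fun n B => B ∩ {σ | σ n ≤ j n B}) n
  have hA : ∀ n, A (n + 1) = A n ∩ {σ | σ n ≤ j n (A n)} := fun n => rfl
  have hAanti : Antitone A := antitone_nat_of_succ_le fun n => by
    rw [hA]
    exact Set.inter_subset_left
  have hAle : ∀ n, ∀ σ ∈ A n, ∀ i < n, σ i ≤ j i (A i) := by
    intro n σ hσ i hi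
    have h1 : σ ∈ A (i + 1) := hAanti hi hσ
    rw [hA] at h1
    exact h1.2
  have hcA : ∀ n, c < gameUpper Q (F (A n)) s := by
    intro n
    induction n with
    | zero =>
      have : F (A 0) = f := by
        have : π '' A 0 = Set.univ := by simp [A, hsurj.range_eq]
        simp only [F, this, Set.indicator_univ]
      rwa [this]
    | succ n ih => exact hj n (A n) ih
  let H : ℕ → List X → ℝ := fun n z => ⨆ ω' : {ω' : Path X // prefixList ω' n = z}, F (A n) ω'
  have hbdd : ∀ n z, BddAbove (Set.range fun ω' : {ω' : Path X // prefixList ω' n = z} =>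
      F (A n) ω') := fun n z => ⟨D, by rintro _ ⟨ω', rfl⟩; exact (hF _ _).2⟩
  have hFH : ∀ n ω, F (A n) ω ≤ H n (prefixList ω n) := fun n ω =>
    le_ciSup (hbdd n (prefixList ω n)) ⟨ω, rfl⟩
  have hHb : ∀ n ω, 0 ≤ H n (prefixList ω n) ∧ H n (prefixList ω n) ≤ D := fun n ω => by
    have : Nonempty {ω' : Path X // prefixList ω' n = prefixList ω n} := ⟨⟨ω, rfl⟩⟩
    exact ⟨(hF _ ω).1.trans (hFH n ω), ciSup_le fun _ => (hF _ _).2⟩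
  have hHanti : Antitone fun n (ω : Path X) => H n (prefixList ω n) := by
    refine antitone_nat_of_succ_le fun n ω => ?_
    have : Nonempty {ω' : Path X // prefixList ω' (n + 1) = prefixList ω (n + 1)} := ⟨⟨ω, rfl⟩⟩
    refine ciSup_le fun ω' => (hFmono (hAanti n.le_succ) _).trans ?_
    have hω' : prefixList ω'.1 n = prefixList ω n := by
      rw [← take_prefixList _ n.le_succ, ω'.2, take_prefixList _ n.le_succ]
    exact le_ciSup (hbdd n (prefixList ω n)) ⟨ω'.1, hω'⟩
  obtain ⟨p, hp, hle⟩ := h.exists_compatible_le_integral hPm hHanti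
    (fun n => ⟨n, fun ω ω' hω => by rw [hω]⟩) (fun n => ⟨0, D, hHb n⟩) (a := c) (s := s) fun n =>
      (hcA n).le.trans (gameUpper_mono (fun ω => (hF _ ω).1) (fun ω => (hHb n ω).2) (hFH n) s)
  have := (hPm p s).1
  refine ⟨p, hp, le_integral_of_antitone hHanti (fun n => measurable_comp_prefixList (H n) n) hHb
    (Integrable.of_mem_Icc 0 D hfm.aemeasurable (Eventually.of_forall hf)) (fun ω r hr => ?_) hle⟩
  rcases lt_or_ge r 0 with hr0 | hr0
  · exact hr0.le.trans (hf ω).1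
  have hex : ∀ n, ∃ σ ∈ A n, prefixList (π σ) n = prefixList ω n ∧ r < f (π σ) := by
    intro n
    have : Nonempty {ω' : Path X // prefixList ω' n = prefixList ω n} := ⟨⟨ω, rfl⟩⟩
    obtain ⟨⟨ω', hω'⟩, hlt⟩ := exists_lt_of_lt_ciSup (hr n)
    by_cases hmem : ω' ∈ π '' A n
    · simp only [F, Set.indicator_of_mem hmem] at hlt
      obtain ⟨σ, hσ, rfl⟩ := hmem
      exact ⟨σ, hσ, hω', hlt⟩
    · simp only [F, Set.indicator_of_notMem hmem] at hlt
      exact absurd hlt (not_lt.2 hr0)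
  choose σ hσA hσp hσr using hex
  obtain ⟨τ, φ, hφ, hτ⟩ := exists_tendsto_subseq_of_le fun n => hAle n (σ n) (hσA n)
  have hlim1 : Tendsto (fun n => π (σ n)) atTop (𝓝 ω) := by
    rw [tendsto_pi_nhds]
    intro i
    refine tendsto_const_nhds.congr' ?_
    filter_upwards [eventually_gt_atTop i] with n hn
    exact (prefixList_eq_iff.1 (hσp n) i hn).symm
  have hlim2 : Tendsto (fun n => π (σ (φ n))) atTop (𝓝 (π τ)) := (hπ.tendsto τ).comp hτ
  rw [tendsto_nhds_unique (hlim1.comp hφ.tendsto_atTop) hlim2]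
  exact ge_of_tendsto' ((hfπ.tendsto τ).comp hτ) fun n => (hσr (φ n)).le

lemma Agree.exists_compatible_le_integral_of_measurable (h : Agree P Q)
    {Pm : PreciseTree X → List X → Measure (Path X)}
    (hPm : ∀ (p : PreciseTree X) (s : List X), IsTreeMeasure p s (Pm p s))
    (hfm : Measurable f) (hf : ∀ ω, b ≤ f ω ∧ f ω ≤ D) (hc : c < gameUpper Q f s) :
    ∃ p : PreciseTree X, Compatible p P ∧ c ≤ ∫ ω, f ω ∂(Pm p s) := by
  obtain ⟨p, hp, hle⟩ := h.exists_compatible_le_integral_of_nonneg hPm (f := fun ω => f ω + -b)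
    (D := D + -b) (c := c + -b) (s := s) (hfm.add_const _)
    (fun ω => ⟨by linarith [(hf ω).1], by linarith [(hf ω).2]⟩)
    ((add_lt_add_left hc _).trans_le (gameUpper_add_const_ge hf _ s))
  have := (hPm p s).1
  rw [integral_add (Integrable.of_mem_Icc b D hfm.aemeasurable (Eventually.of_forall hf))
    (integrable_const _), integral_const, probReal_univ, one_smul] at hle
  exact ⟨p, hp, by linarith⟩

end Capacitability

/-! ### Extended real variables -/

section ExtendedReal

lemma EReal.coe_toReal_inf {x : EReal} {b : ℝ} (hx : (b : EReal) ≤ x) (e : ℝ) :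
    ((x ⊓ (e : EReal)).toReal : EReal) = x ⊓ (e : EReal) :=
  EReal.coe_toReal (inf_le_right.trans_lt (EReal.coe_lt_top e)).ne
    (lt_min ((EReal.bot_lt_coe b).trans_le hx) (EReal.bot_lt_coe e)).ne'

lemma EReal.toReal_inf_bounds {x : EReal} {b : ℝ} (hx : (b : EReal) ≤ x) (e : ℝ) :
    min b e ≤ (x ⊓ (e : EReal)).toReal ∧ (x ⊓ (e : EReal)).toReal ≤ e := by
  have h := coe_toReal_inf hx e
  constructor
  · rw [← EReal.coe_le_coe_iff, h, EReal.coe_strictMono.monotone.map_min]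
    exact inf_le_inf_right _ hx
  · rw [← EReal.coe_le_coe_iff, h]
    exact inf_le_right

lemma posPart_eq_toENNReal (x : EReal) : posPart x = x.toENNReal := rfl

variable {X : Type} {μ : Measure (Path X)} {f g : Path X → EReal}

lemma IsFinGamble.neg {f : Path X → EReal} (hf : IsFinGamble f) :
    IsFinGamble fun ω => -(f ω) := by
  obtain ⟨⟨n, hn⟩, B, hB⟩ := hf
  exact ⟨⟨n, fun ω ω' h => congrArg Neg.neg (hn ω ω' h)⟩, B, fun ω =>
    ⟨EReal.neg_le_neg_iff.2 (hB ω).2, EReal.neg_le.1 (hB ω).1⟩⟩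

lemma IsGamble.coe_toReal (hf : IsGamble f) (ω : Path X) : ((f ω).toReal : EReal) = f ω := by
  obtain ⟨B, hB⟩ := hf
  exact EReal.coe_toReal ((hB ω).2.trans_lt (EReal.coe_lt_top B)).ne
    (((EReal.bot_lt_coe (-B)).trans_le ((EReal.coe_neg B).le)).trans_le (hB ω).1).ne'

lemma IsGamble.exists_toReal_bound (hf : IsGamble f) :
    ∃ B : ℝ, ∀ ω, -B ≤ (f ω).toReal ∧ (f ω).toReal ≤ B := by
  have h := hf.coe_toReal
  obtain ⟨B, hB⟩ := hf
  refine ⟨B, fun ω => ?_⟩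
  have := hB ω
  rw [← h ω] at this
  exact_mod_cast this

lemma IsGamble.exists_le (hf : IsGamble f) : ∃ b : ℝ, ∀ ω, (b : EReal) ≤ f ω := by
  obtain ⟨B, hB⟩ := hf
  exact ⟨-B, fun ω => (EReal.coe_neg B).le.trans (hB ω).1⟩

section Integral

lemma integralE_mono (h : ∀ ω, f ω ≤ g ω) : integralE μ f ≤ integralE μ g := by
  refine EReal.sub_le_sub ?_ ?_ <;>
    refine EReal.coe_ennreal_le_coe_ennreal_iff.2 (lintegral_mono fun ω => ?_)
  · exact EReal.toENNReal_le_toENNReal (h ω)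
  · exact EReal.toENNReal_le_toENNReal (EReal.neg_le_neg_iff.2 (h ω))

lemma integralE_coe {k : Path X → ℝ} (hk : Integrable k μ) :
    integralE μ (fun ω => (k ω : EReal)) = ((∫ ω, k ω ∂μ : ℝ) : EReal) := by
  rw [integral_eq_lintegral_pos_part_sub_lintegral_neg_part hk, EReal.coe_sub,
    EReal.coe_ennreal_toReal (hk.lintegral_lt_top).ne,
    EReal.coe_ennreal_toReal (show Integrable (fun ω => -k ω) μ from hk.neg).lintegral_lt_top.ne]
  rfl

lemma integralE_le_of_inf_le [IsProbabilityMeasure μ] (hg : Measurable g) {b : ℝ}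
    (hb : ∀ ω, (b : EReal) ≤ g ω) {S : EReal}
    (h : ∀ n : ℕ, integralE μ (fun ω => g ω ⊓ ((n : ℝ) : EReal)) ≤ S) : integralE μ g ≤ S := by
  have hneg : ∀ (n : ℕ) ω, posPart (-(g ω ⊓ ((n : ℝ) : EReal))) = posPart (-(g ω)) := by
    intro n ω
    rcases le_total (g ω) ((n : ℝ) : EReal) with hle | hle
    · rw [inf_eq_left.2 hle]
    · have h0 : (0 : EReal) ≤ ((n : ℝ) : EReal) := by exact_mod_cast n.cast_nonneg
      rw [inf_eq_right.2 hle, posPart_eq_toENNReal, posPart_eq_toENNReal,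
        EReal.toENNReal_of_nonpos, EReal.toENNReal_of_nonpos]
      · simpa using h0.trans hle
      · simp
  have hfin : ∫⁻ ω, posPart (-(g ω)) ∂μ ≠ ⊤ := by
    refine ((lintegral_mono (g := fun _ => ENNReal.ofReal (-b)) fun ω => ?_).trans_lt ?_).ne
    · exact EReal.toENNReal_le_toENNReal (x := -(g ω)) (y := ((-b : ℝ) : EReal))
        (by rw [EReal.coe_neg]; exact EReal.neg_le_neg_iff.2 (hb ω))
    · simp
  have hN1 : ((∫⁻ ω, posPart (-(g ω)) ∂μ : ℝ≥0∞) : EReal) ≠ ⊥ := EReal.coe_ennreal_ne_bot _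
  have hN2 : ((∫⁻ ω, posPart (-(g ω)) ∂μ : ℝ≥0∞) : EReal) ≠ ⊤ := by simpa using hfin
  have hlim : Tendsto (fun n : ℕ => ∫⁻ ω, posPart (g ω ⊓ ((n : ℝ) : EReal)) ∂μ) atTop
      (𝓝 (∫⁻ ω, posPart (g ω) ∂μ)) := by
    refine lintegral_tendsto_of_tendsto_of_monotone
      (fun n => (hg.min measurable_const).ereal_toENNReal.aemeasurable)
      (Eventually.of_forall fun ω i j hij => EReal.toENNReal_le_toENNReal ?_)
      (Eventually.of_forall fun ω => ?_)
    · exact inf_le_inf_left _ (by exact_mod_cast hij)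
    · refine (EReal.continuous_toENNReal.tendsto _).comp ?_
      have := (tendsto_const_nhds (x := g ω)).min
        (EReal.tendsto_coe_nhds_top_iff.2 (tendsto_natCast_atTop_atTop (R := ℝ)))
      rwa [min_eq_left le_top] at this
  rw [integralE, EReal.sub_le_iff_le_add (Or.inl hN1) (Or.inl hN2)]
  refine le_of_tendsto' ((continuous_coe_ennreal_ereal.tendsto _).comp hlim) fun n => ?_
  have := h n
  simp only [integralE, hneg] at this
  rwa [EReal.sub_le_iff_le_add (Or.inl hN1) (Or.inl hN2)] at this

lemma le_upperInt_of_le_integral [IsProbabilityMeasure μ] {a C e : ℝ} {k : Path X → ℝ}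
    (hk : Measurable k) (hkb : ∀ ω, C ≤ k ω ∧ k ω ≤ e) (ha : a ≤ ∫ ω, k ω ∂μ)
    (hle : ∀ ω, (k ω : EReal) ≤ f ω) : (a : EReal) ≤ upperInt μ f := by
  refine le_sInf ?_
  rintro _ ⟨g, -, -, hfg, rfl⟩
  refine le_trans ?_ (integralE_mono fun ω => (hle ω).trans (hfg ω))
  rw [integralE_coe (Integrable.of_mem_Icc C e hk.aemeasurable (Eventually.of_forall hkb))]
  exact_mod_cast ha

end Integral

variable [Fintype X] [Nonempty X]

lemma IsFinGamble.measurable {f : Path X → EReal} (hf : IsFinGamble f) : Measurable f := by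
  obtain ⟨⟨n, hn⟩, -⟩ := hf
  let G : List X → EReal := fun z => f (extendPath z)
  have : f = fun ω => G (prefixList ω n) := by
    funext ω
    refine hn _ _ ?_
    have h := prefixList_extendPath (prefixList ω n)
    rw [length_prefixList] at h
    exact h.symm
  rw [this]
  exact measurable_comp_prefixList G n

lemma measurable_of_tendsto_finGamble {fn : ℕ → Path X → EReal} (hfn : ∀ n, IsFinGamble (fn n))
    (hlim : ∀ ω, Tendsto (fun n => fn n ω) atTop (𝓝 (f ω))) : Measurable f :=
  measurable_of_tendsto_metrizable (fun n => (hfn n).measurable) (tendsto_pi_nhds.2 hlim)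

variable {Q : UpperExpTree X} {s : List X}

lemma gtBB_eq_iSup_gameUpper {b : ℝ} (hf : ∀ ω, (b : EReal) ≤ f ω) :
    gtBB Q f s = ⨆ e : ℝ, (gameUpper Q (fun ω => (f ω ⊓ (e : EReal)).toReal) s : EReal) :=
  iSup_congr fun e => gtG_eq_coe_gameUpper (fun ω => EReal.toReal_inf_bounds (hf ω) e) s

variable [DecidableEq X] {P : ImpreciseTree X} {Pm : PreciseTree X → List X → Measure (Path X)}

lemma Agree.muUE_le_gtUE (h : Agree P Q)
    (hPm : ∀ (p : PreciseTree X) (s : List X), IsTreeMeasure p s (Pm p s)) (hf : Measurable f) :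
    muUE Pm P f s ≤ gtUE Q f s := by
  refine iSup₂_le fun p hp => le_iInf fun c => ?_
  have := (hPm p s).1
  have hm : Measurable fun ω => f ω ⊔ (c : EReal) := hf.max measurable_const
  have hb : ∀ ω, (c : EReal) ≤ f ω ⊔ (c : EReal) := fun ω => le_sup_right
  refine le_trans (b := integralE (Pm p s) fun ω => f ω ⊔ (c : EReal))
    (sInf_le ⟨_, hm, ⟨c, hb⟩, fun ω => le_sup_left, rfl⟩) ?_
  refine integralE_le_of_inf_le hm hb fun n => ?_
  have hkm : Measurable fun ω => ((f ω ⊔ (c : EReal)) ⊓ ((n : ℝ) : EReal)).toReal :=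
    (hm.min measurable_const).ereal_toReal
  have hkb := fun ω => EReal.toReal_inf_bounds (hb ω) n
  rw [← funext fun ω => EReal.coe_toReal_inf (hb ω) n, integralE_coe
    (Integrable.of_mem_Icc _ _ hkm.aemeasurable (Eventually.of_forall hkb)),
    gtBB_eq_iSup_gameUpper hb]
  refine le_trans ?_ (le_iSup _ (n : ℝ))
  exact EReal.coe_le_coe_iff.2 ((hPm p s).integral_le_gameUpper hp h hkm hkb)

lemma Agree.gtUE_le_muUE_of_bddBelow (h : Agree P Q)
    (hPm : ∀ (p : PreciseTree X) (s : List X), IsTreeMeasure p s (Pm p s)) (hf : Measurable f)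
    {b : ℝ} (hb : ∀ ω, (b : EReal) ≤ f ω) : gtUE Q f s ≤ muUE Pm P f s := by
  refine (iInf_le _ b).trans ?_
  have hsup : (fun ω => f ω ⊔ (b : EReal)) = f := funext fun ω => sup_eq_left.2 (hb ω)
  rw [hsup, gtBB_eq_iSup_gameUpper hb]
  refine iSup_le fun e => ?_
  have hkb := fun ω => EReal.toReal_inf_bounds (hb ω) e
  have hkm : Measurable fun ω => (f ω ⊓ (e : EReal)).toReal :=
    (hf.min measurable_const).ereal_toReal
  refine EReal.ge_of_forall_gt_iff_ge.1 fun a ha => ?_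
  obtain ⟨p, hp, hle⟩ :=
    h.exists_compatible_le_integral_of_measurable hPm hkm hkb (EReal.coe_lt_coe_iff.1 ha)
  have := (hPm p s).1
  refine le_trans ?_ (le_iSup₂ (f := fun p _ => upperInt (Pm p s) f) p hp)
  refine le_upperInt_of_le_integral hkm hkb hle fun ω => ?_
  rw [EReal.coe_toReal_inf (hb ω)]
  exact inf_le_left

lemma Agree.gtUE_le_muUE_of_antitone (h : Agree P Q)
    (hPm : ∀ (p : PreciseTree X) (s : List X), IsTreeMeasure p s (Pm p s))
    {fn : ℕ → Path X → EReal} (hfn : ∀ n, IsFinGamble (fn n)) (hanti : Antitone fn)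
    (hlim : ∀ ω, Tendsto (fun n => fn n ω) atTop (𝓝 (f ω))) (hf : Measurable f) :
    gtUE Q f s ≤ muUE Pm P f s := by
  have hle : ∀ n ω, f ω ≤ fn n ω := fun n ω =>
    le_of_tendsto (hlim ω) (eventually_atTop.2 ⟨n, fun m hm => hanti hm ω⟩)
  have hcoe := fun n => (hfn n).2.coe_toReal
  choose B hB using fun n => (hfn n).2.exists_toReal_bound
  have hfnm : ∀ n, Measurable fun ω => (fn n ω).toReal := fun n => (hfn n).measurable.ereal_toReal
  have hrealanti : Antitone fun n ω => (fn n ω).toReal := fun n m hnm ω => by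
    rw [← EReal.coe_le_coe_iff, hcoe, hcoe]
    exact hanti hnm ω
  refine EReal.ge_of_forall_gt_iff_ge.1 fun a ha => ?_
  have hgame : ∀ n, a ≤ gameUpper Q (fun ω => (fn n ω).toReal) s := by
    intro n
    have h1 : (a : EReal) ≤ gtBB Q (fun ω => f ω ⊔ ((-B n : ℝ) : EReal)) s :=
      ha.le.trans (iInf_le _ _)
    have hb : ∀ ω, ((-B n : ℝ) : EReal) ≤ f ω ⊔ ((-B n : ℝ) : EReal) := fun ω => le_sup_right
    rw [gtBB_eq_iSup_gameUpper hb] at h1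
    refine EReal.coe_le_coe_iff.1 (h1.trans (iSup_le fun e => EReal.coe_le_coe_iff.2 ?_))
    refine gameUpper_mono (fun ω => (EReal.toReal_inf_bounds (hb ω) e).1) (fun ω => (hB n ω).2)
      (fun ω => ?_) s
    rw [← EReal.coe_le_coe_iff, EReal.coe_toReal_inf (hb ω), hcoe]
    refine inf_le_left.trans (sup_le (hle n ω) ?_)
    rw [← hcoe]
    exact EReal.coe_le_coe_iff.2 (hB n ω).1
  obtain ⟨p, hp, hint⟩ := h.exists_compatible_le_integral hPm (s := s) hrealanti
    (fun n => (hfn n).1.imp fun N hN ω ω' hω => congrArg EReal.toReal (hN ω ω' hω))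
    (fun n => ⟨-B n, B n, hB n⟩) hgame
  have := (hPm p s).1
  refine le_trans ?_ (le_iSup₂ (f := fun p _ => upperInt (Pm p s) f) p hp)
  refine le_sInf ?_
  rintro _ ⟨g, -, ⟨C, hC⟩, hfg, rfl⟩
  have hb : ∀ ω, (C : EReal) ≤ f ω ⊔ (C : EReal) := fun ω => le_sup_right
  let e := max (B 0) C
  let k : Path X → ℝ := fun ω => ((f ω ⊔ (C : EReal)) ⊓ (e : EReal)).toReal
  have hkm : Measurable k := ((hf.max measurable_const).min measurable_const).ereal_toReal
  have hkint : Integrable k (Pm p s) := Integrable.of_mem_Icc _ _ hkm.aemeasurable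
    (Eventually.of_forall fun ω => EReal.toReal_inf_bounds (hb ω) e)
  have hk : ∀ ω, (k ω : EReal) = (f ω ⊔ (C : EReal)) ⊓ (e : EReal) := fun ω =>
    EReal.coe_toReal_inf (hb ω) e
  have hak : a ≤ ∫ ω, k ω ∂(Pm p s) := by
    refine le_integral_of_antitone (g := fun n ω => max (fn n ω).toReal C) (b := C) (c := e)
      (fun n m hnm ω => max_le_max_right _ (hrealanti hnm ω))
      (fun n => (hfnm n).max measurable_const)
      (fun n ω => ⟨le_max_right _ _, max_le_max_right _ ((hrealanti n.zero_le ω).trans (hB 0 ω).2)⟩)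
      hkint (fun ω r hr => ?_) fun n => (hint n).trans (integral_mono ?_ ?_ fun ω => ?_)
    · rw [← EReal.coe_le_coe_iff, hk]
      refine le_inf (ge_of_tendsto' ((hlim ω).max tendsto_const_nhds) fun n => ?_)
        (EReal.coe_le_coe_iff.2 ?_)
      · rw [← hcoe, ← EReal.coe_strictMono.monotone.map_max]
        exact EReal.coe_le_coe_iff.2 (hr n).le
      · exact (hr 0).le.trans (max_le_max_right _ (hB 0 ω).2)
    · exact Integrable.of_mem_Icc _ _ (hfnm n).aemeasurable (Eventually.of_forall (hB n))
    · exact Integrable.of_mem_Icc C (max (B n) C) ((hfnm n).max measurable_const).aemeasurable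
        (Eventually.of_forall fun ω => ⟨le_max_right _ _, max_le_max_right _ (hB n ω).2⟩)
    · exact le_max_left _ _
  calc (a : EReal) ≤ ((∫ ω, k ω ∂(Pm p s) : ℝ) : EReal) := EReal.coe_le_coe_iff.2 hak
    _ = integralE (Pm p s) (fun ω => (k ω : EReal)) := (integralE_coe hkint).symm
    _ ≤ integralE (Pm p s) g := integralE_mono fun ω => by
      rw [hk]
      exact inf_le_left.trans (sup_le (hfg ω) (hC ω))

theorem Agree.muUE_eq_gtUE (h : Agree P Q)
    (hPm : ∀ (p : PreciseTree X) (s : List X), IsTreeMeasure p s (Pm p s))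
    (hf : (∃ fn : ℕ → Path X → EReal, (∀ n, IsFinGamble (fn n)) ∧
            (Monotone fn ∨ Antitone fn) ∧
            ∀ ω, Tendsto (fun n => fn n ω) atTop (𝓝 (f ω))) ∨
         (Measurable f ∧ IsGamble f)) :
    muUE Pm P f s = gtUE Q f s := by
  rcases hf with ⟨fn, hfn, hmono | hanti, hlim⟩ | ⟨hm, hb⟩
  · have hm := measurable_of_tendsto_finGamble hfn hlim
    obtain ⟨b, hb⟩ := (hfn 0).2.exists_le
    exact (h.muUE_le_gtUE hPm hm).antisymm (h.gtUE_le_muUE_of_bddBelow hPm hm (b := b) fun ω =>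
      ge_of_tendsto' (hlim ω) fun n => (hb ω).trans (hmono n.zero_le ω))
  · have hm := measurable_of_tendsto_finGamble hfn hlim
    exact (h.muUE_le_gtUE hPm hm).antisymm (h.gtUE_le_muUE_of_antitone hPm hfn hanti hlim hm)
  · obtain ⟨b, hb⟩ := hb.exists_le
    exact (h.muUE_le_gtUE hPm hm).antisymm (h.gtUE_le_muUE_of_bddBelow hPm hm hb)

end ExtendedReal

theorem stmt14 (P : ImpreciseTree X) (Q : UpperExpTree X)
    (Pm : PreciseTree X → List X → Measure (Path X))
    (hPm : ∀ (p : PreciseTree X) (s : List X), IsTreeMeasure p s (Pm p s))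
    (hagree : Agree P Q) (s : List X) (f : Path X → EReal)
    (h : (∃ fn : ℕ → Path X → EReal, (∀ n, IsFinGamble (fn n)) ∧
            (Monotone fn ∨ Antitone fn) ∧
            ∀ ω, Tendsto (fun n => fn n ω) atTop (nhds (f ω))) ∨
         (Measurable f ∧ IsGamble f)) :
    muUE Pm P f s = gtUE Q f s ∧
      -(muUE Pm P (fun ω => -(f ω)) s) = -(gtUE Q (fun ω => -(f ω)) s) := by
  refine ⟨hagree.muUE_eq_gtUE hPm h, congrArg Neg.neg (hagree.muUE_eq_gtUE hPm ?_)⟩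
  rcases h with ⟨fn, hfn, hmono, hlim⟩ | ⟨hm, B, hB⟩
  · refine Or.inl ⟨fun n ω => -(fn n ω), fun n => (hfn n).neg, ?_, fun ω =>
      (continuous_neg.tendsto _).comp (hlim ω)⟩
    exact hmono.symm.imp
      (fun h i j hij ω => EReal.neg_le_neg_iff.2 (h hij ω))
      (fun h i j hij ω => EReal.neg_le_neg_iff.2 (h hij ω))
  · exact Or.inr ⟨continuous_neg.measurable.comp hm, B, fun ω =>
      ⟨EReal.neg_le_neg_iff.2 (hB ω).2, EReal.neg_le.1 (hB ω).1⟩⟩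

end UEPaper
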